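/- arXiv:1910.05638 — 3 statements merged into one kernel-verified Lean document; each statement's English description precedes it below -/
import Mathlib

section
/- For any group G, the geometric realization of the nerve of the poset of all cosets gN, where N ranges over the proper normal finite-index subgroups of G, ordered by inclusion, is contractible if and only if the poset of proper normal finite-index subgroups of G has infinitely many maximal elements. -/
open scoped Pointwise

/-- The coset poset associated with a family `F` of subgroups of `G`: the set of
all cosets `g • H` with `g ∈ G` and `H ∈ F`, partially ordered by inclusion. -/
def CosetPoset (G : Type) [Group G] (F : Set (Subgroup G)) : Type _ :=
  {X : Set G // ∃ H ∈ F, ∃ g : G, X = g • (H : Set G)}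

instance {G : Type} [Group G] {F : Set (Subgroup G)} : PartialOrder (CosetPoset G F) :=
  Subtype.partialOrder _

/-- The geometric realization of the nerve of the coset poset of the family `F`. -/
noncomputable def cosetNerveRealization (G : Type) [Group G] (F : Set (Subgroup G)) : TopCat :=
  SSet.toTop.obj (CategoryTheory.nerve (CosetPoset G F))

/-- The geometric order complex of a poset: finitely supported convex weights whose support is
a chain. -/
def OrderComplex (P : Type) [PartialOrder P] : Type :=
  {w : P →₀ ℝ // (∀ p, 0 ≤ w p) ∧ (w.sum fun _ a ↦ a) = 1 ∧
    IsChain (· ≤ ·) (w.support : Set P)}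

namespace OrderComplex

variable {P : Type} [PartialOrder P]

/-- The barycentric coordinates of a point of the order complex. -/
def wt (w : OrderComplex P) : P →₀ ℝ := w.1

@[ext]
lemma ext {w w' : OrderComplex P} (h : ∀ p, w.wt p = w'.wt p) : w = w' :=
  Subtype.ext (Finsupp.ext h)

lemma wt_nonneg (w : OrderComplex P) (p : P) : 0 ≤ w.wt p := w.2.1 p

lemma sum_wt (w : OrderComplex P) : (w.wt.sum fun _ a ↦ a) = 1 := w.2.2.1

lemma isChain_support (w : OrderComplex P) : IsChain (· ≤ ·) (w.wt.support : Set P) := w.2.2.2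

lemma support_nonempty (w : OrderComplex P) : w.wt.support.Nonempty := by
  by_contra h
  have h1 := w.sum_wt
  rw [Finset.not_nonempty_iff_eq_empty, Finsupp.support_eq_empty] at h
  simp [h] at h1

lemma sum_eq_one_of_support_subset (w : OrderComplex P) {Q : Finset P} (h : w.wt.support ⊆ Q) :
    ∑ p ∈ Q, w.wt p = 1 := by
  rw [← w.sum_wt, Finsupp.sum_of_support_subset _ h _ (fun _ _ ↦ rfl)]

/-- The point of the order complex with given weights on a finite set. -/
noncomputable def mk' (Q : Finset P) (a : P → ℝ) (h0 : ∀ p ∈ Q, 0 ≤ a p) (h1 : ∑ p ∈ Q, a p = 1)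
    (hc : ∀ p ∈ Q, ∀ q ∈ Q, a p ≠ 0 → a q ≠ 0 → p ≤ q ∨ q ≤ p) : OrderComplex P :=
  ⟨∑ p ∈ Q, Finsupp.single p (a p), by
    classical
    have key : ∀ p, (∑ p ∈ Q, Finsupp.single p (a p)) p = if p ∈ Q then a p else 0 := by
      intro p
      simp [Finsupp.finsetSum_apply, Finsupp.single_apply]
    refine ⟨fun p ↦ ?_, ?_, ?_⟩
    · rw [key]; split_ifs with h
      · exact h0 p h
      · rfl
    · rw [← Finsupp.sum_finsetSum_index (by simp) (by simp)]
      simpa using h1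
    · intro p hp q hq _
      simp only [Finset.mem_coe, Finsupp.mem_support_iff, key, ne_eq, ite_eq_right_iff,
        not_forall] at hp hq
      obtain ⟨hp, hp'⟩ := hp
      obtain ⟨hq, hq'⟩ := hq
      exact hc p hp q hq hp' hq'⟩

open Classical in
lemma mk'_wt {Q : Finset P} {a : P → ℝ} (h0 h1 hc) (p : P) :
    (mk' Q a h0 h1 hc).wt p = if p ∈ Q then a p else 0 := by
  simp [mk', wt, Finsupp.finsetSum_apply, Finsupp.single_apply]

/-- The simplex of the order complex spanned by a monotone family of vertices. -/
noncomputable def push {n : ℕ} (σ : Fin (n + 1) →o P) (t : stdSimplex ℝ (Fin (n + 1))) :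
    OrderComplex P :=
  ⟨∑ i, Finsupp.single (σ i) (t i), by
    classical
    have key : ∀ p, (∑ i, Finsupp.single (σ i) (t i)) p = ∑ i, if σ i = p then t i else 0 := by
      intro p
      simp [Finsupp.finsetSum_apply, Finsupp.single_apply]
    refine ⟨fun p ↦ ?_, ?_, ?_⟩
    · rw [key]
      exact Finset.sum_nonneg fun i _ ↦ by split_ifs; exacts [t.2.1 i, le_rfl]
    · rw [← Finsupp.sum_finsetSum_index (by simp) (by simp)]
      simp
    · have hr : ∀ p, p ∈ (∑ i, Finsupp.single (σ i) (t i)).support → ∃ i, σ i = p := by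
        intro p hp
        rw [Finsupp.mem_support_iff, key] at hp
        obtain ⟨i, -, hi⟩ := Finset.exists_ne_zero_of_sum_ne_zero hp
        exact ⟨i, by by_contra h; simp [h] at hi⟩
      intro p hp q hq _
      obtain ⟨i, rfl⟩ := hr p hp
      obtain ⟨j, rfl⟩ := hr q hq
      exact (le_total i j).imp (fun h ↦ σ.monotone h) (fun h ↦ σ.monotone h)⟩

open Classical in
lemma push_wt {n : ℕ} (σ : Fin (n + 1) →o P) (t : stdSimplex ℝ (Fin (n + 1))) (p : P) :
    (push σ t).wt p = ∑ i, if σ i = p then t i else 0 := by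
  simp [push, wt, Finsupp.finsetSum_apply, Finsupp.single_apply]

lemma exists_of_mem_support_push {n : ℕ} {σ : Fin (n + 1) →o P} {t : stdSimplex ℝ (Fin (n + 1))}
    {p : P} (hp : p ∈ (push σ t).wt.support) : ∃ i, σ i = p := by
  classical
  rw [Finsupp.mem_support_iff, push_wt] at hp
  obtain ⟨i, -, hi⟩ := Finset.exists_ne_zero_of_sum_ne_zero hp
  exact ⟨i, by by_contra h; simp [h] at hi⟩

lemma push_wt_of_injective {n : ℕ} {σ : Fin (n + 1) →o P} (hσ : Function.Injective σ)
    (t : stdSimplex ℝ (Fin (n + 1))) (i : Fin (n + 1)) : (push σ t).wt (σ i) = t i := by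
  classical
  simp [push_wt, hσ.eq_iff]

lemma push_comp {n m : ℕ} (σ : Fin (n + 1) →o P) (f : Fin (m + 1) →o Fin (n + 1))
    (t : stdSimplex ℝ (Fin (m + 1))) :
    push (σ.comp f) t = push σ (stdSimplex.map f t) := by
  classical
  ext p
  simp only [push_wt, OrderHom.comp_coe, Function.comp_apply, stdSimplex.map_coe,
    FunOnFinite.linearMap_apply_apply]
  simp only [← Finset.sum_filter]
  rw [Finset.sum_sigma']
  refine Finset.sum_bij' (fun i _ ↦ ⟨f i, i⟩) (fun x _ ↦ x.2) ?_ ?_ ?_ ?_ ?_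
  · simp
  · simp only [Finset.mem_sigma, Finset.mem_filter, Finset.mem_univ, true_and]
    rintro ⟨a, b⟩ ⟨h, h'⟩
    exact (congrArg σ h').trans h
  · simp
  · simp only [Finset.mem_sigma, Finset.mem_filter, Finset.mem_univ, true_and]
    rintro ⟨a, b⟩ ⟨-, h⟩
    exact Sigma.ext h HEq.rfl
  · simp

/-- Integration of a function on the vertices against the weights. -/
noncomputable def integral (φ : P → ℝ) (w : OrderComplex P) : ℝ :=
  w.wt.sum fun p a ↦ a * φ p

lemma integral_push (φ : P → ℝ) {n : ℕ} (σ : Fin (n + 1) →o P)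
    (t : stdSimplex ℝ (Fin (n + 1))) : integral φ (push σ t) = ∑ i, t i * φ (σ i) := by
  simp only [integral, wt, push]
  rw [← Finsupp.sum_finsetSum_index (by simp) (by intros; ring)]
  simp

/-- The weak topology, determined by the simplices. -/
noncomputable instance : TopologicalSpace (OrderComplex P) :=
  ⨆ (n : ℕ) (σ : Fin (n + 1) →o P), TopologicalSpace.coinduced (push σ) inferInstance

lemma continuous_push {n : ℕ} (σ : Fin (n + 1) →o P) : Continuous (push σ) :=
  continuous_iff_coinduced_le.2 (le_iSup₂_of_le n σ le_rfl)

lemma continuous_iff {Z : Type*} [TopologicalSpace Z] {f : OrderComplex P → Z} :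
    Continuous f ↔ ∀ (n : ℕ) (σ : Fin (n + 1) →o P), Continuous fun t ↦ f (push σ t) := by
  refine ⟨fun h n σ ↦ h.comp (continuous_push σ), fun h ↦ ?_⟩
  refine continuous_iSup_dom.2 fun n ↦ continuous_iSup_dom.2 fun σ ↦ continuous_coinduced_dom.2 ?_
  exact h n σ

lemma isOpen_iff {U : Set (OrderComplex P)} :
    IsOpen U ↔ ∀ (n : ℕ) (σ : Fin (n + 1) →o P), IsOpen (push σ ⁻¹' U) := by
  rw [isOpen_iSup_iff]
  simp only [isOpen_iSup_iff, isOpen_coinduced]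

lemma continuous_coord {n : ℕ} (i : Fin (n + 1)) :
    Continuous fun t : stdSimplex ℝ (Fin (n + 1)) ↦ t i :=
  (continuous_apply i).comp continuous_subtype_val

lemma continuous_wt (p : P) : Continuous fun w : OrderComplex P ↦ w.wt p := by
  classical
  refine continuous_iff.2 fun n σ ↦ ?_
  simp only [push_wt]
  refine continuous_finsetSum _ fun i _ ↦ ?_
  split_ifs
  exacts [continuous_coord i, continuous_const]

lemma continuous_integral (φ : P → ℝ) : Continuous (integral φ) := by
  refine continuous_iff.2 fun n σ ↦ ?_
  simp only [integral_push]
  exact continuous_finsetSum _ fun i _ ↦ (continuous_coord i).mul continuous_const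

/-- Every point lies in the simplex spanned by its support. -/
lemma exists_eq_push (w : OrderComplex P) : ∃ (n : ℕ) (σ : Fin (n + 1) →o P)
    (t : stdSimplex ℝ (Fin (n + 1))), StrictMono σ ∧ (∀ i, 0 < t i) ∧ push σ t = w := by
  classical
  obtain ⟨n, hn⟩ : ∃ n, w.wt.support.card = n + 1 :=
    Nat.exists_eq_succ_of_ne_zero (Finset.card_pos.2 w.support_nonempty).ne'
  let S : Finset (LinearExtension P) := w.wt.support
  let e := S.orderEmbOfFin hn
  have hmem : ∀ i, (e i : P) ∈ w.wt.support := fun i ↦ S.orderEmbOfFin_mem hn i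
  let σ : Fin (n + 1) → P := fun i ↦ e i
  have hσ : StrictMono σ := by
    intro i j hij
    have h1 : e i < e j := e.strictMono hij
    have hne : σ i ≠ σ j := fun h ↦ h1.ne h
    rcases w.isChain_support (hmem i) (hmem j) hne with h | h
    · exact lt_of_le_of_ne h hne
    · exact absurd (toLinearExtension.monotone h) (not_le_of_gt h1)
  have himg : ∀ p ∈ w.wt.support, ∃ i, σ i = p := by
    intro p hp
    have := S.range_orderEmbOfFin hn
    have hp' : (p : LinearExtension P) ∈ Set.range (S.orderEmbOfFin hn) := by
      rw [this]; exact hp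
    exact hp'
  have hpos : ∀ i, 0 < w.wt (σ i) := fun i ↦
    lt_of_le_of_ne (w.wt_nonneg _) (Finsupp.mem_support_iff.1 (hmem i)).symm
  have hsum : ∑ i, w.wt (σ i) = 1 := by
    rw [← w.sum_wt, Finsupp.sum]
    refine Finset.sum_bij (fun i _ ↦ σ i) (fun i _ ↦ hmem i) (fun i _ j _ h ↦ hσ.injective h)
      (fun p hp ↦ ?_) (fun _ _ ↦ rfl)
    obtain ⟨i, hi⟩ := himg p hp
    exact ⟨i, Finset.mem_univ _, hi⟩
  refine ⟨n, ⟨σ, hσ.monotone⟩, ⟨fun i ↦ w.wt (σ i), fun i ↦ (hpos i).le, hsum⟩, hσ, hpos, ?_⟩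
  ext p
  by_cases hp : p ∈ w.wt.support
  · obtain ⟨i, rfl⟩ := himg p hp
    exact push_wt_of_injective (σ := ⟨σ, hσ.monotone⟩) hσ.injective _ i
  · rw [Finsupp.notMem_support_iff.1 hp]
    by_contra h
    obtain ⟨i, hi⟩ := exists_of_mem_support_push (Finsupp.mem_support_iff.2 h)
    exact hp (hi ▸ hmem i)

end OrderComplex

namespace OrderComplex

open CategoryTheory Simplicial Opposite

variable {P : Type} [PartialOrder P]

/-- The simplex of the nerve with given monotone family of vertices. -/
def nerveSimplex {n : ℕ} (σ : Fin (n + 1) →o P) : (nerve P).obj (op ⦋n⦌) :=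
  (σ.monotone.functor : Fin (n + 1) ⥤ P)

/-- The vertices of a simplex of the nerve. -/
def vertices {n : ℕ} (s : (nerve P).obj (op ⦋n⦌)) : Fin (n + 1) →o P :=
  Functor.toOrderHom (show Fin (n + 1) ⥤ P from s)

lemma nerveSimplex_vertices {n : ℕ} (s : (nerve P).obj (op ⦋n⦌)) :
    nerveSimplex (vertices s) = s :=
  nerve.ext_of_isThin rfl

/-- The affine parametrization of a simplex of the geometric realization of the nerve. -/
noncomputable def cell {n : ℕ} (σ : Fin (n + 1) →o P) (t : stdSimplex ℝ (Fin (n + 1))) :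
    SSet.toTop.obj (nerve P) :=
  SSet.toTop.map (SSet.yonedaEquiv.symm (nerveSimplex σ))
    ((SimplexCategory.toTopHomeo ⦋n⦌).symm t)

lemma continuous_cell {n : ℕ} (σ : Fin (n + 1) →o P) : Continuous (cell σ) :=
  (SSet.toTop.map (SSet.yonedaEquiv.symm (nerveSimplex σ))).hom.continuous.comp
    (SimplexCategory.toTopHomeo ⦋n⦌).symm.continuous

lemma cell_comp {n m : ℕ} (σ : Fin (n + 1) →o P) (f : Fin (m + 1) →o Fin (n + 1))
    (t : stdSimplex ℝ (Fin (m + 1))) :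
    cell (σ.comp f) t = cell σ (stdSimplex.map f t) := by
  let F : ⦋m⦌ ⟶ ⦋n⦌ := SimplexCategory.Hom.mk f
  have h1 := SimplexCategory.toTopHomeo_symm_naturality_apply.{0} F t
  have h2 : SSet.yonedaEquiv.symm (nerveSimplex (σ.comp f)) =
      SSet.stdSimplex.map F ≫ SSet.yonedaEquiv.symm (nerveSimplex σ) :=
    (SSet.yonedaEquiv_symm_naturality_left (X := nerve P) F (nerveSimplex σ)).symm
  unfold cell
  rw [h2]
  erw [h1]
  rw [Functor.map_comp]
  rfl

/-- The comparison morphism of simplicial sets adjoint to `toOrderComplex`. -/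
noncomputable def toSing : nerve P ⟶ TopCat.toSSet.obj (TopCat.of (OrderComplex P)) where
  app n := ↾fun s ↦ (TopCat.toSSetObjEquiv _ n).symm
    ⟨push (vertices (n := n.unop.len) s), continuous_push _⟩
  naturality n m f := by
    ext s
    refine Equiv.injective (TopCat.toSSetObjEquiv _ _) ?_
    ext t : 1
    exact push_comp (vertices (n := n.unop.len) s) f.unop.toOrderHom t

/-- The map from the geometric realization of the nerve to the order complex. -/
noncomputable def toOrderComplex : SSet.toTop.obj (nerve P) ⟶ TopCat.of (OrderComplex P) :=
  (sSetTopAdj.homEquiv _ _).symm toSing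

lemma homEquiv_apply_cell {Z : TopCat.{0}} (F : SSet.toTop.obj (nerve P) ⟶ Z) {n : ℕ}
    (σ : Fin (n + 1) →o P) (t : stdSimplex ℝ (Fin (n + 1))) :
    TopCat.toSSetObjEquiv Z (op ⦋n⦌)
      ((sSetTopAdj.homEquiv _ _ F).app (op ⦋n⦌) (nerveSimplex σ)) t = F (cell σ t) := by
  rw [Adjunction.homEquiv_unit]
  change F ((TopCat.Hom.hom (((sSetTopAdj.unit.app (nerve P)).app (op ⦋n⦌)) (nerveSimplex σ)).down) (ULift.up t)) = _
  erw [sSetTopAdj_unit_app_app_down (nerve P) (op ⦋n⦌) (nerveSimplex σ)]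
  rfl

lemma toOrderComplex_cell {n : ℕ} (σ : Fin (n + 1) →o P) (t : stdSimplex ℝ (Fin (n + 1))) :
    toOrderComplex (cell σ t) = push σ t := by
  rw [← homEquiv_apply_cell, toOrderComplex, Equiv.apply_symm_apply]
  rfl

lemma hom_ext_cell {Z : TopCat.{0}} {F F' : SSet.toTop.obj (nerve P) ⟶ Z}
    (h : ∀ (n : ℕ) (σ : Fin (n + 1) →o P) (t : stdSimplex ℝ (Fin (n + 1))),
      F (cell σ t) = F' (cell σ t)) : F = F' := by
  refine (sSetTopAdj.homEquiv _ _).injective ?_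
  ext n s
  obtain ⟨n⟩ := n
  induction n using SimplexCategory.rec with | _ n
  refine Equiv.injective (TopCat.toSSetObjEquiv _ _) (ContinuousMap.ext fun t ↦ ?_)
  rw [← nerveSimplex_vertices s]
  erw [homEquiv_apply_cell F, homEquiv_apply_cell F']
  exact h n _ t

lemma exists_cell (x : SSet.toTop.obj (nerve P)) :
    ∃ (n : ℕ) (σ : Fin (n + 1) →o P) (t : stdSimplex ℝ (Fin (n + 1))), cell σ t = x := by
  classical
  by_contra hx
  let Z : TopCat.{0} := @TopCat.of Bool ⊤
  let F : SSet.toTop.obj (nerve P) ⟶ Z :=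
    @TopCat.ofHom _ Bool _ ⊤ (@ContinuousMap.mk _ _ _ ⊤ (fun _ ↦ true) continuous_top)
  let F' : SSet.toTop.obj (nerve P) ⟶ Z :=
    @TopCat.ofHom _ Bool _ ⊤ (@ContinuousMap.mk _ _ _ ⊤ (fun y ↦ decide (∃ (n : ℕ)
      (σ : Fin (n + 1) →o P) (t : stdSimplex ℝ (Fin (n + 1))), cell σ t = y)) continuous_top)
  have : F = F' := hom_ext_cell fun n σ t ↦ (decide_eq_true ⟨_, _, _, rfl⟩).symm
  have h2 : F x = F' x := by rw [this]
  exact hx (of_decide_eq_true h2.symm)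

lemma cell_eq_of_pos {n m : ℕ} {σ : Fin (n + 1) →o P} {t : stdSimplex ℝ (Fin (n + 1))}
    {τ : Fin (m + 1) →o P} {u : stdSimplex ℝ (Fin (m + 1))} (hτ : StrictMono τ)
    (ht : ∀ i, 0 < t i) (h : push σ t = push τ u) : cell σ t = cell τ u := by
  classical
  have h1 : ∀ i, ∃ j, τ j = σ i := fun i ↦ by
    refine exists_of_mem_support_push (t := u) ?_
    rw [← h, Finsupp.mem_support_iff, push_wt]
    refine (lt_of_lt_of_le (ht i) ?_).ne'
    refine (le_of_eq (by simp)).trans (Finset.single_le_sum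
      (f := fun j ↦ if σ j = σ i then t j else 0) (fun j _ ↦ ?_) (Finset.mem_univ i))
    split_ifs; exacts [(ht j).le, le_rfl]
  choose g hg using h1
  have hgm : Monotone g := fun i j hij ↦ by
    rw [← hτ.le_iff_le, hg, hg]; exact σ.monotone hij
  have h2 : σ = τ.comp ⟨g, hgm⟩ := by ext i; exact (hg i).symm
  rw [h2, cell_comp]
  congr 1
  rw [h2, push_comp] at h
  ext i
  rw [← push_wt_of_injective hτ.injective, ← push_wt_of_injective hτ.injective, h]

lemma cell_eq_of_strictMono {n m : ℕ} {σ : Fin (n + 1) →o P} {t : stdSimplex ℝ (Fin (n + 1))}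
    {τ : Fin (m + 1) →o P} {u : stdSimplex ℝ (Fin (m + 1))} (hτ : StrictMono τ)
    (h : push σ t = push τ u) : cell σ t = cell τ u := by
  classical
  let J := Finset.univ.filter fun i ↦ t i ≠ 0
  have hJ : J.Nonempty := by
    by_contra hJ
    have h0 : ∀ i, t i = 0 := by simpa [J, Finset.filter_eq_empty_iff] using hJ
    have := stdSimplex.sum_eq_one t
    simp [h0] at this
  obtain ⟨k, hk⟩ : ∃ k, J.card = k + 1 := Nat.exists_eq_succ_of_ne_zero (Finset.card_pos.2 hJ).ne'
  let f : Fin (k + 1) →o Fin (n + 1) := (J.orderEmbOfFin hk).toOrderHom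
  have hfJ : ∀ i, t (f i) ≠ 0 := fun i ↦ by
    exact (Finset.mem_filter.1 (J.orderEmbOfFin_mem hk i)).2
  have hfr : ∀ j, t j ≠ 0 → ∃ i, f i = j := fun j hj ↦ by
    have : j ∈ Set.range (J.orderEmbOfFin hk) := by
      rw [J.range_orderEmbOfFin hk]; simpa [J] using hj
    exact this
  have hfi : Function.Injective f := (J.orderEmbOfFin hk).injective
  have hsum : ∑ i, t (f i) = 1 := by
    rw [← stdSimplex.sum_eq_one t]
    refine Finset.sum_of_injOn f hfi.injOn (by simp) (fun j _ hj ↦ ?_) (fun _ _ ↦ rfl)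
    by_contra hj'
    obtain ⟨i, hi⟩ := hfr j hj'
    exact hj ⟨i, by simp, hi⟩
  let v : stdSimplex ℝ (Fin (k + 1)) := ⟨fun i ↦ t (f i), fun i ↦ t.2.1 _, hsum⟩
  have hv : stdSimplex.map f v = t := by
    ext j
    simp only [stdSimplex.map_coe, FunOnFinite.linearMap_apply_apply]
    by_cases hj : t j = 0
    · rw [hj]
      refine Finset.sum_eq_zero fun i hi ↦ ?_
      simp only [Finset.mem_filter, Finset.mem_univ, true_and] at hi
      exact (congrArg t hi).trans hj
    · obtain ⟨i, rfl⟩ := hfr j hj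
      simp only [hfi.eq_iff]
      rw [Finset.sum_filter]
      simp
      rfl
  rw [← hv, ← cell_comp]
  rw [← hv, ← push_comp] at h
  exact cell_eq_of_pos hτ (fun i ↦ lt_of_le_of_ne (t.2.1 _) (hfJ i).symm) h

lemma toOrderComplex_injective : Function.Injective (toOrderComplex (P := P)) := by
  intro x y hxy
  obtain ⟨n, σ, t, rfl⟩ := exists_cell x
  obtain ⟨m, τ, u, rfl⟩ := exists_cell y
  rw [toOrderComplex_cell, toOrderComplex_cell] at hxy
  obtain ⟨k, ρ, v, hρ, -, hv⟩ := exists_eq_push (push σ t)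
  rw [cell_eq_of_strictMono hρ hv.symm, cell_eq_of_strictMono hρ (hxy.symm.trans hv.symm)]

lemma toOrderComplex_surjective : Function.Surjective (toOrderComplex (P := P)) := by
  intro w
  obtain ⟨k, ρ, v, -, -, hv⟩ := exists_eq_push (show OrderComplex P from w)
  exact ⟨cell ρ v, (toOrderComplex_cell ρ v).trans hv⟩

/-- The geometric realization of the nerve of a poset is homeomorphic to the order complex. -/
noncomputable def nerveHomeo : SSet.toTop.obj (nerve P) ≃ₜ OrderComplex P :=
  Equiv.toHomeomorphOfContinuousOpen
    (Equiv.ofBijective (toOrderComplex (P := P))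
      ⟨toOrderComplex_injective, toOrderComplex_surjective⟩)
    (toOrderComplex (P := P)).hom.continuous (by
      intro U hU
      refine isOpen_iff.2 fun n σ ↦ ?_
      convert hU.preimage (continuous_cell σ) using 1
      ext t
      simp only [Set.mem_preimage]
      rw [← toOrderComplex_cell]
      exact toOrderComplex_injective.mem_set_image)

end OrderComplex

namespace OrderComplex

variable {P : Type} [PartialOrder P]

instance : T2Space (OrderComplex P) :=
  T2Space.of_injective_continuous (f := fun (w : OrderComplex P) p ↦ w.wt p)
    (fun _ _ h ↦ ext (congrFun h)) (continuous_pi continuous_wt)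

lemma finite_setOf_orderHom (n : ℕ) (Q : Finset P) :
    {σ : Fin (n + 1) →o P | ∀ i, σ i ∈ Q}.Finite := by
  refine Set.Finite.of_finite_image (f := fun σ i ↦ σ i) ?_
    (fun _ _ _ _ h ↦ OrderHom.ext _ _ h)
  refine (Set.Finite.pi' fun _ : Fin (n + 1) ↦ Q.finite_toSet).subset ?_
  rintro _ ⟨σ, hσ, rfl⟩
  exact hσ

lemma isCompact_setOf_support_subset (Q : Finset P) :
    IsCompact {w : OrderComplex P | w.wt.support ⊆ Q} := by
  have : {w : OrderComplex P | w.wt.support ⊆ Q} = ⋃ n ∈ Set.Iio Q.card,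
      ⋃ σ ∈ {σ : Fin (n + 1) →o P | ∀ i, σ i ∈ Q}, Set.range (push σ) := by
    ext w
    simp only [Set.mem_ofPred_eq, Set.mem_iUnion, Set.mem_range, Set.mem_Iio, exists_prop]
    constructor
    · intro hw
      obtain ⟨n, σ, t, hσ, ht, rfl⟩ := exists_eq_push w
      have hQ : ∀ i, σ i ∈ Q := fun i ↦ hw (by
        rw [Finsupp.mem_support_iff, push_wt_of_injective hσ.injective]
        exact (ht i).ne')
      refine ⟨n, ?_, σ, hQ, t, rfl⟩
      have := Finset.card_le_card_of_injOn (s := Finset.univ) σ (fun i _ ↦ hQ i) hσ.injective.injOn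
      simpa using this
    · rintro ⟨n, -, σ, hσ, t, rfl⟩ p hp
      obtain ⟨i, rfl⟩ := exists_of_mem_support_push hp
      exact hσ i
  rw [this]
  refine (Set.finite_Iio _).isCompact_biUnion fun n _ ↦ ?_
  exact (finite_setOf_orderHom n Q).isCompact_biUnion fun σ _ ↦
    isCompact_range (continuous_push σ)

/-- A map with values in a finite subcomplex is continuous if its coordinates are. -/
lemma continuous_of_support_subset {Z : Type*} [TopologicalSpace Z] (Q : Finset P)
    {f : Z → OrderComplex P} (hs : ∀ z, (f z).wt.support ⊆ Q)
    (hc : ∀ p ∈ Q, Continuous fun z ↦ (f z).wt p) : Continuous f := by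
  have : CompactSpace {w : OrderComplex P | w.wt.support ⊆ Q} :=
    isCompact_iff_compactSpace.1 (isCompact_setOf_support_subset Q)
  let e : {w : OrderComplex P | w.wt.support ⊆ Q} → P → ℝ := fun w p ↦ w.1.wt p
  have he : Topology.IsClosedEmbedding e := by
    refine Continuous.isClosedEmbedding ?_ fun _ _ h ↦ Subtype.ext (ext (congrFun h))
    exact continuous_pi fun p ↦ (continuous_wt p).comp continuous_subtype_val
  have hf : Continuous fun z ↦ (⟨f z, hs z⟩ : {w : OrderComplex P | w.wt.support ⊆ Q}) := by
    rw [he.isInducing.continuous_iff, continuous_pi_iff]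
    intro p
    by_cases hp : p ∈ Q
    · exact hc p hp
    · refine (continuous_const (y := (0 : ℝ))).congr fun z ↦ ?_
      exact (Finsupp.notMem_support_iff.1 fun h ↦ hp (hs z h)).symm
  exact continuous_subtype_val.comp hf

/-- A compact set of points involves only finitely many vertices. -/
lemma exists_finset_support_subset {K : Type*} [TopologicalSpace K] [CompactSpace K]
    {u : K → OrderComplex P} (hu : Continuous u) :
    ∃ Q : Finset P, ∀ k, (u k).wt.support ⊆ Q := by
  classical
  let S : Set P := {p | ∃ k, p ∈ (u k).wt.support}
  suffices h : S.Finite by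
    refine ⟨h.toFinset, fun k p hp ↦ ?_⟩
    rw [Set.Finite.mem_toFinset]
    exact ⟨k, hp⟩
  by_contra hS
  let p := Set.Infinite.natEmbedding S hS
  choose y hy using fun n ↦ (p n).2
  have hpos : ∀ n, 0 < (u (y n)).wt (p n) := fun n ↦
    lt_of_le_of_ne (wt_nonneg _ _) (Finsupp.mem_support_iff.1 (hy n)).symm
  have hinj : Function.Injective fun n ↦ (p n : P) := Subtype.val_injective.comp p.injective
  let φ : P → ℝ := Function.extend (fun n ↦ (p n : P))
    (fun n ↦ (n : ℝ) / (u (y n)).wt (p n)) fun _ ↦ 0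
  have hφp : ∀ n, φ (p n) = (n : ℝ) / (u (y n)).wt (p n) := fun n ↦ hinj.extend_apply _ _ n
  have hφ : ∀ q, 0 ≤ φ q := fun q ↦ by
    by_cases hq : ∃ n, (p n : P) = q
    · obtain ⟨n, rfl⟩ := hq
      rw [hφp]
      exact div_nonneg n.cast_nonneg (hpos n).le
    · exact (Function.extend_apply' _ (fun _ ↦ (0 : ℝ)) _ hq).ge
  obtain ⟨B, hB⟩ := (isCompact_range ((continuous_integral φ).comp hu)).bddAbove
  obtain ⟨n, hn⟩ := exists_nat_gt B
  have h1 : integral φ (u (y n)) ≤ B := hB ⟨y n, rfl⟩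
  have h2 : (n : ℝ) ≤ integral φ (u (y n)) := by
    have : (n : ℝ) = (u (y n)).wt (p n) * φ (p n) := by
      rw [hφp, mul_div_cancel₀ _ (hpos n).ne']
    rw [this]
    exact Finset.single_le_sum (f := fun q ↦ (u (y n)).wt q * φ q)
      (fun q _ ↦ mul_nonneg (wt_nonneg _ _) (hφ q)) (hy n)
  linarith

end OrderComplex

namespace OrderComplex

variable {P : Type} [PartialOrder P]

open Classical in
/-- The part of the weight of `q` that has not yet moved at time `s` of the prism homotopy. -/
noncomputable def lowerWt (Q : Finset P) (w : OrderComplex P) (s : ℝ) (q : P) : ℝ :=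
  min (w.wt q) (max 0 (1 - s - ∑ p ∈ Q with p < q, w.wt p))

section

variable {Q : Finset P} {w : OrderComplex P} {s : ℝ} {p q : P}

lemma lowerWt_nonneg : 0 ≤ lowerWt Q w s q := le_min (w.wt_nonneg q) (le_max_left _ _)

lemma lowerWt_le : lowerWt Q w s q ≤ w.wt q := min_le_left _ _

lemma lowerWt_zero (hw : w.wt.support ⊆ Q) (hq : q ∈ Q) : lowerWt Q w 0 q = w.wt q := by
  classical
  refine min_eq_left (le_max_of_le_right ?_)
  have h1 : ∑ p ∈ insert q (Q.filter (· < q)), w.wt p ≤ ∑ p ∈ Q, w.wt p :=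
    Finset.sum_le_sum_of_subset_of_nonneg
      (Finset.insert_subset hq (Finset.filter_subset _ _)) fun p _ _ ↦ w.wt_nonneg p
  rw [Finset.sum_insert (by simp), w.sum_eq_one_of_support_subset hw] at h1
  linarith

lemma lowerWt_one : lowerWt Q w 1 q = 0 := by
  classical
  have : 0 ≤ ∑ p ∈ Q with p < q, w.wt p := Finset.sum_nonneg fun p _ ↦ w.wt_nonneg p
  rw [lowerWt, max_eq_left (by linarith), min_eq_right (w.wt_nonneg q)]

lemma le_of_lowerWt_ne_zero (hq : q ∈ Q) (hpa : lowerWt Q w s p ≠ 0)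
    (hqb : w.wt q - lowerWt Q w s q ≠ 0) : p ≤ q := by
  classical
  have hp0 : w.wt p ≠ 0 := fun h ↦
    hpa (le_antisymm (h ▸ lowerWt_le) lowerWt_nonneg)
  have hq0 : w.wt q ≠ 0 := fun h ↦ hqb (by
    rw [h, le_antisymm (h ▸ lowerWt_le : lowerWt Q w s q ≤ 0) lowerWt_nonneg, sub_zero])
  by_contra hpq
  have hqp : q < p := by
    have hne : p ≠ q := fun h ↦ hpq h.le
    refine lt_of_le_of_ne ?_ hne.symm
    exact (w.isChain_support (Finsupp.mem_support_iff.2 hp0) (Finsupp.mem_support_iff.2 hq0)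
      hne).resolve_left hpq
  have h1 : ∑ r ∈ insert q (Q.filter (· < q)), w.wt r ≤ ∑ r ∈ Q with r < p, w.wt r := by
    refine Finset.sum_le_sum_of_subset_of_nonneg ?_ fun p _ _ ↦ w.wt_nonneg p
    refine Finset.insert_subset (by simp [hq, hqp]) fun r hr ↦ ?_
    simp only [Finset.mem_filter] at hr ⊢
    exact ⟨hr.1, hr.2.trans hqp⟩
  rw [Finset.sum_insert (by simp)] at h1
  have h2 : 0 < 1 - s - ∑ r ∈ Q with r < p, w.wt r := by
    by_contra h
    exact hpa (by rw [lowerWt, max_eq_left (not_lt.1 h), min_eq_right (w.wt_nonneg p)])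
  have h3 : 1 - s - ∑ r ∈ Q with r < q, w.wt r < w.wt q := by
    by_contra h
    exact hqb (by rw [lowerWt, min_eq_left (le_max_of_le_right (not_lt.1 h)), sub_self])
  linarith

end

open Classical in
/-- Pushing a point along two comparable monotone maps, up to time `s` of the prism homotopy. -/
lemma exists_prism {Q : Finset P} {f g : P → P} (hf : ∀ p ∈ Q, ∀ q ∈ Q, p ≤ q → f p ≤ f q)
    (hg : ∀ p ∈ Q, ∀ q ∈ Q, p ≤ q → g p ≤ g q) (hfg : ∀ q ∈ Q, f q ≤ g q)
    (w : OrderComplex P) (hw : w.wt.support ⊆ Q) (s : ℝ) :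
    ∃ w' : OrderComplex P, ∀ p, w'.wt p = ∑ q ∈ Q, ((if f q = p then lowerWt Q w s q else 0) +
      (if g q = p then w.wt q - lowerWt Q w s q else 0)) := by
  set W : P → ℝ := fun p ↦ ∑ q ∈ Q, ((if f q = p then lowerWt Q w s q else 0) +
      (if g q = p then w.wt q - lowerWt Q w s q else 0)) with hW
  have hsupp : ∀ p, W p ≠ 0 → ∃ q ∈ Q, (f q = p ∧ lowerWt Q w s q ≠ 0) ∨
      (g q = p ∧ w.wt q - lowerWt Q w s q ≠ 0) := by
    intro p hp
    obtain ⟨q, hq, h⟩ := Finset.exists_ne_zero_of_sum_ne_zero hp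
    refine ⟨q, hq, ?_⟩
    by_contra! h'
    refine h ?_
    rw [ite_eq_right_iff.2 h'.1, ite_eq_right_iff.2 h'.2, add_zero]
  have hcomp : ∀ p ∈ Q, ∀ q ∈ Q, w.wt p ≠ 0 → w.wt q ≠ 0 → p ≤ q ∨ q ≤ p := by
    intro p _ q _ h h'
    by_cases hpq : p = q
    · exact Or.inl hpq.le
    · exact w.isChain_support (Finsupp.mem_support_iff.2 h) (Finsupp.mem_support_iff.2 h') hpq
  have ha : ∀ q, lowerWt Q w s q ≠ 0 → w.wt q ≠ 0 := fun q hq h ↦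
    hq (le_antisymm (h ▸ lowerWt_le) lowerWt_nonneg)
  have hb : ∀ q, w.wt q - lowerWt Q w s q ≠ 0 → w.wt q ≠ 0 := fun q hq h ↦ hq (by
    rw [h, le_antisymm (h ▸ lowerWt_le : lowerWt Q w s q ≤ 0) lowerWt_nonneg, sub_zero])
  refine ⟨mk' (Q.image f ∪ Q.image g) W ?_ ?_ ?_, fun p ↦ ?_⟩
  · intro p _
    refine Finset.sum_nonneg fun q _ ↦ add_nonneg ?_ ?_
    · split_ifs; exacts [lowerWt_nonneg, le_rfl]
    · split_ifs; exacts [sub_nonneg.2 lowerWt_le, le_rfl]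
  · rw [hW, Finset.sum_comm, ← w.sum_eq_one_of_support_subset hw]
    refine Finset.sum_congr rfl fun q hq ↦ ?_
    have h1 : f q ∈ Q.image f ∪ Q.image g :=
      Finset.mem_union_left _ (Finset.mem_image_of_mem _ hq)
    have h2 : g q ∈ Q.image f ∪ Q.image g :=
      Finset.mem_union_right _ (Finset.mem_image_of_mem _ hq)
    rw [Finset.sum_add_distrib, Finset.sum_ite_eq, Finset.sum_ite_eq, if_pos h1, if_pos h2]
    ring
  · intro p _ p' _ hp hp'
    obtain ⟨q, hq, ⟨rfl, h⟩ | ⟨rfl, h⟩⟩ := hsupp p hp <;>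
      obtain ⟨q', hq', ⟨rfl, h'⟩ | ⟨rfl, h'⟩⟩ := hsupp p' hp'
    · exact (hcomp q hq q' hq' (ha q h) (ha q' h')).imp (hf _ hq _ hq') (hf _ hq' _ hq)
    · exact Or.inl ((hfg q hq).trans (hg _ hq _ hq' (le_of_lowerWt_ne_zero hq' h h')))
    · exact Or.inr ((hfg q' hq').trans (hg _ hq' _ hq (le_of_lowerWt_ne_zero hq h' h)))
    · exact (hcomp q hq q' hq' (hb q h) (hb q' h')).imp (hg _ hq _ hq') (hg _ hq' _ hq)
  · rw [mk'_wt]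
    refine ite_eq_left_iff.2 fun hp ↦ ?_
    by_contra h
    obtain ⟨q, hq, ⟨rfl, -⟩ | ⟨rfl, -⟩⟩ := hsupp p (Ne.symm h)
    · exact hp (Finset.mem_union_left _ (Finset.mem_image_of_mem _ hq))
    · exact hp (Finset.mem_union_right _ (Finset.mem_image_of_mem _ hq))

open Classical in
/-- Two comparable monotone maps induce homotopic maps. -/
lemma exists_prism_homotopy {K : Type*} [TopologicalSpace K] {Q : Finset P} {f g : P → P}
    (hf : ∀ p ∈ Q, ∀ q ∈ Q, p ≤ q → f p ≤ f q) (hg : ∀ p ∈ Q, ∀ q ∈ Q, p ≤ q → g p ≤ g q)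
    (hfg : ∀ q ∈ Q, f q ≤ g q) (u : C(K, OrderComplex P)) (hu : ∀ k, (u k).wt.support ⊆ Q) :
    ∃ v v' : C(K, OrderComplex P), v.Homotopic v' ∧
      (∀ k p, (v k).wt p = ∑ q ∈ Q, if f q = p then (u k).wt q else 0) ∧
      (∀ k p, (v' k).wt p = ∑ q ∈ Q, if g q = p then (u k).wt q else 0) := by
  choose H hH using fun z : unitInterval × K ↦ exists_prism hf hg hfg (u z.2) (hu z.2) z.1
  have hHc : Continuous H := by
    refine continuous_of_support_subset (Q.image f ∪ Q.image g) (fun z p hp ↦ ?_) fun p _ ↦ ?_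
    · rw [Finsupp.mem_support_iff, hH] at hp
      obtain ⟨q, hq, h⟩ := Finset.exists_ne_zero_of_sum_ne_zero hp
      by_contra hp'
      have h1 : f q ≠ p := fun h ↦ hp' (h ▸ Finset.mem_union_left _ (Finset.mem_image_of_mem _ hq))
      have h2 : g q ≠ p := fun h ↦ hp' (h ▸ Finset.mem_union_right _ (Finset.mem_image_of_mem _ hq))
      simp [h1, h2] at h
    · simp only [hH]
      have hwt : ∀ q, Continuous fun z : unitInterval × K ↦ (u z.2).wt q := fun q ↦
        (continuous_wt q).comp (u.continuous.comp continuous_snd)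
      have hl : ∀ q, Continuous fun z : unitInterval × K ↦ lowerWt Q (u z.2) z.1 q := fun q ↦ by
        unfold lowerWt
        refine (hwt q).min (continuous_const.max (Continuous.sub (by fun_prop) ?_))
        exact continuous_finsetSum _ fun p _ ↦ hwt p
      refine continuous_finsetSum _ fun q _ ↦ Continuous.add ?_ ?_
      · split_ifs; exacts [hl q, continuous_const]
      · split_ifs; exacts [(hwt q).sub (hl q), continuous_const]
  refine ⟨⟨fun k ↦ H (0, k), by fun_prop⟩, ⟨fun k ↦ H (1, k), by fun_prop⟩,
    ⟨⟨⟨H, hHc⟩, fun _ ↦ rfl, fun _ ↦ rfl⟩⟩, fun k p ↦ ?_, fun k p ↦ ?_⟩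
  · refine (hH (0, k) p).trans (Finset.sum_congr rfl fun q hq ↦ ?_)
    simp [lowerWt_zero (hu k) hq]
  · refine (hH (1, k) p).trans (Finset.sum_congr rfl fun q hq ↦ ?_)
    simp [lowerWt_one]

/-- If every finite set of vertices can be pushed down and then up to a single vertex, maps from
compact spaces are nullhomotopic. -/
lemma nullhomotopic_of_cone
    (hP : ∀ Q : Finset P, ∃ (f : P → P) (m : P), (∀ p ∈ Q, ∀ q ∈ Q, p ≤ q → f p ≤ f q) ∧
      (∀ q ∈ Q, f q ≤ q) ∧ ∀ q ∈ Q, f q ≤ m)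
    {K : Type*} [TopologicalSpace K] [CompactSpace K] (u : C(K, OrderComplex P)) :
    u.Nullhomotopic := by
  classical
  obtain ⟨Q, hQ⟩ := exists_finset_support_subset u.continuous
  obtain ⟨f, m, hf, hfq, hfm⟩ := hP Q
  obtain ⟨v₁, v₂, h₁, hv₁, hv₂⟩ :=
    exists_prism_homotopy (g := id) hf (fun _ _ _ _ h ↦ h) hfq u hQ
  obtain ⟨v₃, v₄, h₂, hv₃, hv₄⟩ :=
    exists_prism_homotopy (g := fun _ ↦ m) hf (fun _ _ _ _ _ ↦ le_rfl) hfm u hQ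
  have e₁ : v₂ = u := by
    ext k p
    rw [hv₂]
    simp only [id, Finset.sum_ite_eq', ite_eq_left_iff]
    exact fun hp ↦ (Finsupp.notMem_support_iff.1 fun h ↦ hp (hQ k h)).symm
  have e₂ : v₃ = v₁ := by
    ext k p
    rw [hv₃, hv₁]
  have e₃ : v₄ = ContinuousMap.const K (mk' {m} 1 (by simp) (by simp) (by simp)) := by
    ext k p
    rw [hv₄, ContinuousMap.const_apply, mk'_wt]
    by_cases hp : m = p
    · simp [hp, sum_eq_one_of_support_subset _ (hQ k)]
    · simp [hp, Ne.symm hp]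
  subst e₁ e₂ e₃
  exact ⟨_, h₁.symm.trans h₂⟩

end OrderComplex

/-- Extension of a nullhomotopic map from the boundary `γ = 1` of a cone-like space `D` with radial
function `γ` and radial projection `b`. -/
lemma ContinuousMap.Nullhomotopic.exists_extension {D Y : Type*} [TopologicalSpace D]
    [TopologicalSpace Y] {γ : D → ℝ} (hγ : Continuous γ) (h0 : ∀ d, 0 ≤ γ d) (h1 : ∀ d, γ d ≤ 1)
    {b : D → D} (hb : ContinuousOn b {d | γ d ≠ 0}) (hb1 : ∀ d, γ d ≠ 0 → γ (b d) = 1)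
    (hbd : ∀ d, γ d = 1 → b d = d) [CompactSpace {d // γ d = 1}] {f : C({d // γ d = 1}, Y)}
    (hf : f.Nullhomotopic) : ∃ F : C(D, Y), ∀ d, F d.1 = f d := by
  classical
  obtain ⟨y, ⟨H⟩⟩ := hf
  let s : D → unitInterval := fun d ↦ ⟨1 - γ d, sub_nonneg.2 (h1 d), by linarith [h0 d]⟩
  have hs : Continuous s := by fun_prop
  let F : D → Y := fun d ↦ if h : γ d = 0 then y else H (s d, ⟨b d, hb1 d h⟩)
  have hF : Continuous F := by
    refine continuous_iff_continuousAt.2 fun d ↦ ?_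
    by_cases hd : γ d = 0
    · have hy : F d = y := dif_pos hd
      intro U hU
      rw [hy] at hU
      obtain ⟨U', hUU', hU', hyU'⟩ := mem_nhds_iff.1 hU
      have hV : IsOpen {r : unitInterval | Set.MapsTo (H.curry r) Set.univ U'} :=
        (ContinuousMap.isOpen_setOfPred_mapsTo isCompact_univ hU').preimage H.curry.continuous
      have hdV : s d ∈ {r : unitInterval | Set.MapsTo (H.curry r) Set.univ U'} := by
        have : s d = 1 := Subtype.ext (by simp [s, hd])
        intro x _
        rw [this]
        simpa using hyU'
      rw [Filter.mem_map]
      filter_upwards [hs.continuousAt.preimage_mem_nhds (hV.mem_nhds hdV)] with e he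
      refine hUU' ?_
      by_cases h : γ e = 0
      · simpa [F, h] using hyU'
      · simpa [F, h] using he (Set.mem_univ ⟨b e, hb1 e h⟩)
    · have ho : IsOpen {d | γ d ≠ 0} := isOpen_ne.preimage hγ
      refine ContinuousOn.continuousAt (s := {d | γ d ≠ 0}) ?_ (ho.mem_nhds hd)
      rw [continuousOn_iff_continuous_domRestrict] at hb ⊢
      have : Set.domRestrict {d | γ d ≠ 0} F = fun d ↦ H (s d.1, ⟨b d.1, hb1 d.1 d.2⟩) := by
        ext d
        exact dif_neg d.2
      rw [this]
      exact H.continuous.comp ((hs.comp continuous_subtype_val).prodMk (hb.subtype_mk _))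
  refine ⟨⟨F, hF⟩, fun d ↦ ?_⟩
  have hd : γ d.1 ≠ 0 := by rw [d.2]; exact one_ne_zero
  have hs0 : s d.1 = 0 := Subtype.ext (by simp [s, d.2])
  have hbd' : (⟨b d.1, hb1 d.1 hd⟩ : {d // γ d = 1}) = d := Subtype.ext (hbd _ d.2)
  simp only [ContinuousMap.coe_mk, F, dif_neg hd, hbd', hs0]
  simp

namespace OrderComplex

variable {P : Type} [PartialOrder P]

/-- The prism over the closed simplex spanned by a chain `c`. -/
abbrev Prism (c : Finset P) : Type := {w : OrderComplex P // w.wt.support ⊆ c} × unitInterval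

/-- The radial function on the prism over a closed simplex, equal to `1` on its boundary. -/
noncomputable def prismRadius (c : Finset P) (hc : c.Nonempty)
    (d : Prism c) : ℝ :=
  max (c.sup' hc fun p ↦ 1 - c.card * d.1.1.wt p) |2 * (d.2 : ℝ) - 1|

section

variable {c : Finset P} (hc : c.Nonempty)
  (d : Prism c)

lemma continuous_prismRadius : Continuous (prismRadius c hc) := by
  refine Continuous.max (Continuous.finset_sup'_apply hc fun p _ ↦ ?_) (by fun_prop)
  refine continuous_const.sub (continuous_const.mul ?_)
  exact (continuous_wt p).comp (continuous_subtype_val.comp continuous_fst)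

lemma prismRadius_nonneg : 0 ≤ prismRadius c hc d := le_max_of_le_right (abs_nonneg _)

lemma abs_le_prismRadius : |2 * (d.2 : ℝ) - 1| ≤ prismRadius c hc d := le_max_right _ _

lemma le_prismRadius {p : P} (hp : p ∈ c) : 1 - c.card * d.1.1.wt p ≤ prismRadius c hc d :=
  le_max_of_le_left (Finset.le_sup' (fun p ↦ 1 - c.card * d.1.1.wt p) hp)

lemma prismRadius_eq : (∃ p ∈ c, prismRadius c hc d = 1 - c.card * d.1.1.wt p) ∨
    prismRadius c hc d = |2 * (d.2 : ℝ) - 1| := by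
  rcases max_choice (c.sup' hc fun p ↦ 1 - c.card * d.1.1.wt p) |2 * (d.2 : ℝ) - 1| with h | h
  · obtain ⟨p, hp, h'⟩ := Finset.exists_mem_eq_sup' hc fun p ↦ 1 - c.card * d.1.1.wt p
    exact Or.inl ⟨p, hp, h.trans h'⟩
  · exact Or.inr h

lemma prismRadius_le_one : prismRadius c hc d ≤ 1 := by
  rcases prismRadius_eq hc d with ⟨p, -, h⟩ | h
  · rw [h]
    have := mul_nonneg (Nat.cast_nonneg (α := ℝ) c.card) (d.1.1.wt_nonneg p)
    linarith
  · rw [h, abs_le]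
    constructor <;> linarith [d.2.2.1, d.2.2.2]

lemma prismRadius_eq_one_iff : prismRadius c hc d = 1 ↔
    (∃ p ∈ c, d.1.1.wt p = 0) ∨ d.2 = 0 ∨ d.2 = 1 := by
  have hN := Nat.cast_pos (α := ℝ).2 hc.card_pos
  constructor
  · intro h
    rcases prismRadius_eq hc d with ⟨p, hp, h'⟩ | h'
    · refine Or.inl ⟨p, hp, ?_⟩
      rw [h] at h'
      have : c.card * d.1.1.wt p = 0 := by linarith
      exact (mul_eq_zero.1 this).resolve_left hN.ne'
    · rw [h] at h'
      rcases eq_or_eq_neg_of_abs_eq h'.symm with h | h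
      · exact Or.inr (Or.inr (Subtype.ext (by simp only [Set.Icc.coe_one]; linarith)))
      · exact Or.inr (Or.inl (Subtype.ext (by simp only [Set.Icc.coe_zero]; linarith)))
  · intro h
    refine le_antisymm (prismRadius_le_one hc d) ?_
    rcases h with ⟨p, hp, h⟩ | h | h
    · simpa [h] using le_prismRadius hc d hp
    · simpa [h] using abs_le_prismRadius hc d
    · have := abs_le_prismRadius hc d
      rw [h] at this
      norm_num at this
      exact this

/-- The radial projection of the prism over a closed simplex onto its boundary. -/
lemma exists_radial_projection (hcc : ∀ p ∈ c, ∀ q ∈ c, p ≤ q ∨ q ≤ p)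
    (hd : prismRadius c hc d ≠ 0) :
    ∃ d' : Prism c,
      (∀ p ∈ c, d'.1.1.wt p =
        (c.card : ℝ)⁻¹ + (d.1.1.wt p - (c.card : ℝ)⁻¹) / prismRadius c hc d) ∧
      (d'.2 : ℝ) = 1 / 2 + (d.2 - 1 / 2) / prismRadius c hc d := by
  classical
  have hN := Nat.cast_pos (α := ℝ).2 hc.card_pos
  have hγ : 0 < prismRadius c hc d := lt_of_le_of_ne (prismRadius_nonneg hc d) hd.symm
  let a : P → ℝ := fun p ↦ (c.card : ℝ)⁻¹ + (d.1.1.wt p - (c.card : ℝ)⁻¹) / prismRadius c hc d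
  have ha0 : ∀ p ∈ c, 0 ≤ a p := by
    intro p hp
    have h1 := le_prismRadius hc d hp
    have : a p = (prismRadius c hc d - (1 - c.card * d.1.1.wt p)) /
        (c.card * prismRadius c hc d) := by
      simp only [a]
      field_simp
      ring
    rw [this]
    exact div_nonneg (by linarith) (by positivity)
  have ha1 : ∑ p ∈ c, a p = 1 := by
    simp only [a]
    rw [Finset.sum_add_distrib, ← Finset.sum_div, Finset.sum_sub_distrib,
      d.1.1.sum_eq_one_of_support_subset d.1.2]
    simp [hN.ne']
  have hs := abs_le.1 (abs_le_prismRadius hc d)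
  let s' : ℝ := 1 / 2 + (d.2 - 1 / 2) / prismRadius c hc d
  have hs' : s' = (prismRadius c hc d + (2 * d.2 - 1)) / (2 * prismRadius c hc d) := by
    simp only [s']
    field_simp
  have hs0 : 0 ≤ s' := by
    rw [hs']
    exact div_nonneg (by linarith) (by positivity)
  have hs1 : s' ≤ 1 := by
    rw [hs', div_le_one (by positivity)]
    linarith
  have hac : ∀ p ∈ c, ∀ q ∈ c, a p ≠ 0 → a q ≠ 0 → p ≤ q ∨ q ≤ p :=
    fun p hp q hq _ _ ↦ hcc p hp q hq
  refine ⟨⟨⟨mk' c a ha0 ha1 hac, fun p hp ↦ ?_⟩, ⟨s', hs0, hs1⟩⟩,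
    fun p hp ↦ ?_, rfl⟩
  · rw [Finsupp.mem_support_iff, mk'_wt] at hp
    by_contra h
    exact hp (if_neg h)
  · exact (mk'_wt ha0 ha1 hac p).trans (if_pos hp)

lemma prismRadius_radial_projection {d d' : Prism c}
    (hd : prismRadius c hc d ≠ 0)
    (h1 : ∀ p ∈ c, d'.1.1.wt p =
        (c.card : ℝ)⁻¹ + (d.1.1.wt p - (c.card : ℝ)⁻¹) / prismRadius c hc d)
    (h2 : (d'.2 : ℝ) = 1 / 2 + (d.2 - 1 / 2) / prismRadius c hc d) :
    prismRadius c hc d' = 1 := by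
  have hN := Nat.cast_pos (α := ℝ).2 hc.card_pos
  have hγ : 0 < prismRadius c hc d := lt_of_le_of_ne (prismRadius_nonneg hc d) hd.symm
  refine le_antisymm (prismRadius_le_one hc d') ?_
  rcases prismRadius_eq hc d with ⟨p, hp, h⟩ | h
  · refine le_trans (le_of_eq ?_) (le_prismRadius hc d' hp)
    rw [h1 p hp]
    field_simp
    linarith
  · refine le_trans (le_of_eq ?_) (abs_le_prismRadius hc d')
    have : 2 * (d'.2 : ℝ) - 1 = (2 * d.2 - 1) / prismRadius c hc d := by
      rw [h2]
      field_simp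
      ring
    rw [this, abs_div, abs_of_pos hγ, ← h, div_self hd]

end

/-- A continuous radial projection of the prism over a closed simplex onto its boundary. -/
lemma exists_continuousOn_projection {c : Finset P} (hc : c.Nonempty)
    (hcc : ∀ p ∈ c, ∀ q ∈ c, p ≤ q ∨ q ≤ p) :
    ∃ b : Prism c → Prism c, ContinuousOn b {d | prismRadius c hc d ≠ 0} ∧
      (∀ d, prismRadius c hc d ≠ 0 → prismRadius c hc (b d) = 1) ∧
      ∀ d, prismRadius c hc d = 1 → b d = d := by
  classical
  choose b' hb1' hb2' using fun d ↦ exists_radial_projection (c := c) hc d hcc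
  let b : Prism c → Prism c := fun d ↦ if h : prismRadius c hc d ≠ 0 then b' d h else d
  have hb1 : ∀ d, prismRadius c hc d ≠ 0 → ∀ p ∈ c, (b d).1.1.wt p =
      (c.card : ℝ)⁻¹ + (d.1.1.wt p - (c.card : ℝ)⁻¹) / prismRadius c hc d := fun d h ↦ by
    simp only [b, dif_pos h]
    exact hb1' d h
  have hb2 : ∀ d, prismRadius c hc d ≠ 0 → ((b d).2 : ℝ) =
      1 / 2 + (d.2 - 1 / 2) / prismRadius c hc d := fun d h ↦ by
    simp only [b, dif_pos h]
    exact hb2' d h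
  clear_value b
  refine ⟨b, ?_, fun d hd ↦ prismRadius_radial_projection hc hd (hb1 d hd) (hb2 d hd), fun d hd ↦ ?_⟩
  · have hγ : Continuous fun d : {d : Prism c | prismRadius c hc d ≠ 0} ↦ prismRadius c hc d.1 :=
      (continuous_prismRadius hc).comp continuous_subtype_val
    rw [continuousOn_iff_continuous_domRestrict]
    refine Continuous.prodMk (Continuous.subtype_mk ?_ _) (Continuous.subtype_mk ?_ _)
    · refine continuous_of_support_subset c (fun d ↦ (b d.1).1.2) fun p hp ↦ ?_
      refine Continuous.congr ?_ fun d ↦ (hb1 d.1 d.2 p hp).symm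
      refine continuous_const.add (Continuous.div ?_ hγ fun d ↦ d.2)
      exact ((continuous_wt p).comp (continuous_subtype_val.comp
        (continuous_fst.comp continuous_subtype_val))).sub continuous_const
    · refine Continuous.congr ?_ fun d ↦ (hb2 d.1 d.2).symm
      exact continuous_const.add (Continuous.div (by fun_prop) hγ fun d ↦ d.2)
  · have hd0 : prismRadius c hc d ≠ 0 := by rw [hd]; exact one_ne_zero
    refine Prod.ext (Subtype.ext (ext fun p ↦ ?_)) (Subtype.ext ?_)
    · by_cases hp : p ∈ c
      · rw [hb1 d hd0 p hp, hd]
        ring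
      · rw [Finsupp.notMem_support_iff.1 fun h ↦ hp ((b d).1.2 h),
          Finsupp.notMem_support_iff.1 fun h ↦ hp (d.1.2 h)]
    · rw [hb2 d hd0, hd]
      ring

open Classical in
/-- Extending a partially defined contraction over one more prism. -/
lemma exists_prism_extension
    (hn : ∀ (K : Type) [TopologicalSpace K] [CompactSpace K] (u : C(K, OrderComplex P)),
      u.Nullhomotopic)
    (y : OrderComplex P) {c : Finset P} (hc : c.Nonempty)
    (hcc : ∀ p ∈ c, ∀ q ∈ c, p ≤ q ∨ q ≤ p) {H : OrderComplex P → unitInterval → OrderComplex P}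
    (H0 : ∀ w, H w 0 = w) (H1 : ∀ w, H w 1 = y)
    (hH : ∀ p ∈ c, ContinuousOn (Function.uncurry H)
      ({w | w.wt.support ⊆ c.erase p} ×ˢ Set.univ)) :
    ∃ F : C(Prism c, OrderComplex P),
      ∀ d, (d.1.1.wt.support ≠ c ∨ d.2 = 0 ∨ d.2 = 1) → F d = H d.1.1 d.2 := by
  have : CompactSpace {w : OrderComplex P // w.wt.support ⊆ c} :=
    isCompact_iff_compactSpace.1 (isCompact_setOf_support_subset c)
  have hγ := continuous_prismRadius (c := c) hc
  have hcomp : CompactSpace {d : Prism c // prismRadius c hc d = 1} :=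
    isCompact_iff_compactSpace.1 (isClosed_eq hγ continuous_const).isCompact
  have hwt : ∀ p, Continuous fun d : Prism c ↦ d.1.1.wt p := fun p ↦
    (continuous_wt p).comp (continuous_subtype_val.comp continuous_fst)
  obtain ⟨b, hb, hb1, hbd⟩ := exists_continuousOn_projection hc hcc
  let f : {d : Prism c // prismRadius c hc d = 1} → OrderComplex P := fun d ↦ H d.1.1.1 d.1.2
  let cov : Option (Option c) → Set {d : Prism c // prismRadius c hc d = 1} := fun i ↦ match i with
    | none => {d | d.1.2 = 0}
    | some none => {d | d.1.2 = 1}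
    | some (some p) => {d | d.1.1.1.wt p = 0}
  have hf : Continuous f := by
    refine (locallyFinite_of_finite cov).continuous ?_ ?_ ?_
    · refine Set.eq_univ_of_forall fun d ↦ Set.mem_iUnion.2 ?_
      rcases (prismRadius_eq_one_iff hc d.1).1 d.2 with ⟨p, hp, h⟩ | h | h
      exacts [⟨some (some ⟨p, hp⟩), h⟩, ⟨none, h⟩, ⟨some none, h⟩]
    · rintro (_ | _ | p)
      · exact isClosed_eq (continuous_snd.comp continuous_subtype_val) continuous_const
      · exact isClosed_eq (continuous_snd.comp continuous_subtype_val) continuous_const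
      · exact isClosed_eq ((hwt p).comp continuous_subtype_val) continuous_const
    · rintro (_ | _ | p)
      · refine ContinuousOn.congr (f := fun d ↦ d.1.1.1) (by fun_prop) fun d hd ↦ ?_
        have hd : d.1.2 = 0 := hd
        simp only [f, hd, H0]
      · refine ContinuousOn.congr (f := fun _ ↦ y) (by fun_prop) fun d hd ↦ ?_
        have hd : d.1.2 = 1 := hd
        simp only [f, hd, H1]
      · refine (hH p p.2).comp (f := fun d : {d : Prism c // prismRadius c hc d = 1} ↦ (d.1.1.1, d.1.2))
          (by fun_prop) fun d hd ↦ ⟨fun q hq ↦ ?_, trivial⟩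
        have hd : d.1.1.1.wt p = 0 := hd
        refine Finset.mem_erase.2 ⟨?_, d.1.1.2 hq⟩
        rintro rfl
        exact Finsupp.mem_support_iff.1 hq hd
  obtain ⟨F, hF⟩ := (hn _ ⟨f, hf⟩).exists_extension hγ (prismRadius_nonneg hc)
    (prismRadius_le_one hc) hb hb1 hbd
  refine ⟨F, fun d hd ↦ hF ⟨d, (prismRadius_eq_one_iff hc d).2 (hd.imp_left fun h ↦ ?_)⟩⟩
  by_contra! h'
  exact h (Finset.Subset.antisymm d.1.2 fun p hp ↦ Finsupp.mem_support_iff.2 (h' p hp))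

/-- A contraction of the `n`-skeleton, extended arbitrarily. -/
structure SkeletonContraction (y : OrderComplex P) (n : ℕ) where
  /-- The contraction. -/
  toFun : OrderComplex P → unitInterval → OrderComplex P
  map_zero : ∀ w, toFun w 0 = w
  map_one : ∀ w, toFun w 1 = y
  continuousOn : ∀ c : Finset P, c.card ≤ n → (∀ p ∈ c, ∀ q ∈ c, p ≤ q ∨ q ≤ p) →
    ContinuousOn (Function.uncurry toFun) ({w | w.wt.support ⊆ c} ×ˢ Set.univ)

open Classical in
lemma SkeletonContraction.exists_succ
    (hn : ∀ (K : Type) [TopologicalSpace K] [CompactSpace K] (u : C(K, OrderComplex P)),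
      u.Nullhomotopic)
    {y : OrderComplex P} {n : ℕ} (H : SkeletonContraction y n) :
    ∃ H' : SkeletonContraction y (n + 1), ∀ w, w.wt.support.card ≤ n →
      H'.toFun w = H.toFun w := by
  have key : ∀ c : Finset P, c.card = n + 1 → (∀ p ∈ c, ∀ q ∈ c, p ≤ q ∨ q ≤ p) →
      ∃ F : C(Prism c, OrderComplex P),
      ∀ d, (d.1.1.wt.support ≠ c ∨ d.2 = 0 ∨ d.2 = 1) → F d = H.toFun d.1.1 d.2 := by
    intro c hc hcc
    refine exists_prism_extension hn y (Finset.card_pos.1 (by omega)) hcc H.map_zero H.map_one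
      fun p hp ↦ H.continuousOn _ ?_ fun p hp q hq ↦
        hcc p (Finset.mem_of_mem_erase hp) q (Finset.mem_of_mem_erase hq)
    rw [Finset.card_erase_of_mem hp, hc]
    rfl
  choose F hF using key
  have hsupp : ∀ w : OrderComplex P, ∀ p ∈ w.wt.support, ∀ q ∈ w.wt.support, p ≤ q ∨ q ≤ p := by
    intro w p hp q hq
    by_cases hpq : p = q
    · exact Or.inl hpq.le
    · exact w.isChain_support hp hq hpq
  let H' : OrderComplex P → unitInterval → OrderComplex P := fun w s ↦
    if h : w.wt.support.card = n + 1 then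
      F w.wt.support h (hsupp w) (⟨w, Finset.Subset.refl _⟩, s) else H.toFun w s
  have hH' : ∀ (c : Finset P) (hc : c.card = n + 1) (hcc : ∀ p ∈ c, ∀ q ∈ c, p ≤ q ∨ q ≤ p)
      (w : OrderComplex P) (hw : w.wt.support ⊆ c) (s : unitInterval),
      H' w s = F c hc hcc (⟨w, hw⟩, s) := by
    intro c hc hcc w hw s
    by_cases h : w.wt.support = c
    · subst h
      exact dif_pos hc
    · rw [hF c hc hcc _ (Or.inl h)]
      refine dif_neg fun h' ↦ h (Finset.eq_of_subset_of_card_le hw ?_)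
      rw [hc, h']
  have hH : ∀ w : OrderComplex P, w.wt.support.card ≤ n → H' w = H.toFun w := fun w hw ↦
    funext fun s ↦ dif_neg (by omega)
  refine ⟨⟨H', fun w ↦ ?_, fun w ↦ ?_, fun c hc hcc ↦ ?_⟩, hH⟩
  · by_cases h : w.wt.support.card = n + 1
    · exact (dif_pos h).trans ((hF _ h _ _ (Or.inr (Or.inl rfl))).trans (H.map_zero w))
    · exact (dif_neg h).trans (H.map_zero w)
  · by_cases h : w.wt.support.card = n + 1
    · exact (dif_pos h).trans ((hF _ h _ _ (Or.inr (Or.inr rfl))).trans (H.map_one w))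
    · exact (dif_neg h).trans (H.map_one w)
  · rcases Nat.le_or_eq_of_le_succ hc with hc | hc
    · refine (H.continuousOn c hc hcc).congr fun z hz ↦ ?_
      exact congrFun (hH z.1 ((Finset.card_le_card hz.1).trans hc)) z.2
    · rw [continuousOn_iff_continuous_domRestrict]
      have : Set.domRestrict ({w : OrderComplex P | w.wt.support ⊆ c} ×ˢ Set.univ)
          (Function.uncurry H') = fun z ↦ F c hc hcc (⟨z.1.1, z.2.1⟩, z.1.2) :=
        funext fun z ↦ hH' c hc hcc z.1.1 z.2.1 z.1.2
      rw [this]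
      fun_prop

/-- An order complex receiving only nullhomotopic maps from compact spaces is contractible. -/
lemma contractibleSpace_of_nullhomotopic
    (hn : ∀ (K : Type) [TopologicalSpace K] [CompactSpace K] (u : C(K, OrderComplex P)),
      u.Nullhomotopic) : ContractibleSpace (OrderComplex P) := by
  classical
  obtain ⟨y, -⟩ := hn Empty ⟨Empty.elim, by fun_prop⟩
  let H₀ : SkeletonContraction y 0 :=
    ⟨fun w s ↦ if s = 1 then y else w, fun w ↦ by simp, fun w ↦ by simp, fun c hc _ ↦ by
      rw [Nat.le_zero, Finset.card_eq_zero] at hc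
      subst hc
      rintro z ⟨hz, -⟩
      obtain ⟨p, hp⟩ := z.1.support_nonempty
      exact absurd (hz hp) (Finset.notMem_empty p)⟩
  choose S hS using fun (n : ℕ) (H : SkeletonContraction y n) ↦ H.exists_succ hn
  let Hs : (n : ℕ) → SkeletonContraction y n := fun n ↦ Nat.rec H₀ S n
  have hHs : ∀ n k w, w.wt.support.card ≤ n → (Hs (n + k)).toFun w = (Hs n).toFun w := by
    intro n k w hw
    induction k with
    | zero => rfl
    | succ k ih => exact (hS (n + k) (Hs (n + k)) w (by omega)).trans ih
  let H : OrderComplex P → unitInterval → OrderComplex P := fun w ↦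
    (Hs w.wt.support.card).toFun w
  have hcont : ∀ c : Finset P, (∀ p ∈ c, ∀ q ∈ c, p ≤ q ∨ q ≤ p) →
      ContinuousOn (Function.uncurry H) ({w | w.wt.support ⊆ c} ×ˢ Set.univ) := by
    intro c hcc
    refine ((Hs c.card).continuousOn c le_rfl hcc).congr fun z hz ↦ ?_
    obtain ⟨k, hk⟩ := Nat.exists_eq_add_of_le (Finset.card_le_card hz.1)
    change H z.1 z.2 = (Hs c.card).toFun z.1 z.2
    rw [hk, hHs _ _ _ le_rfl]
  have hpush : ∀ (n : ℕ) (σ : Fin (n + 1) →o P), Continuous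
      fun z : stdSimplex ℝ (Fin (n + 1)) × unitInterval ↦ H (push σ z.1) z.2 := by
    intro n σ
    refine (hcont (Finset.univ.image σ) ?_).comp_continuous
      (f := fun z : stdSimplex ℝ (Fin (n + 1)) × unitInterval ↦ (push σ z.1, z.2))
      (((continuous_push σ).comp continuous_fst).prodMk continuous_snd) fun z ↦ ⟨fun p hp ↦ ?_,
        trivial⟩
    · simp only [Finset.mem_image, Finset.mem_univ, true_and]
      rintro _ ⟨i, rfl⟩ _ ⟨j, rfl⟩
      exact (le_total i j).imp (fun h ↦ σ.monotone h) (fun h ↦ σ.monotone h)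
    · obtain ⟨i, rfl⟩ := exists_of_mem_support_push hp
      exact Finset.mem_image_of_mem _ (Finset.mem_univ i)
  have hH : ∀ w, Continuous (H w) := by
    intro w
    obtain ⟨n, σ, t, -, -, rfl⟩ := exists_eq_push w
    exact (hpush n σ).comp (by fun_prop : Continuous fun s : unitInterval ↦ (t, s))
  let Φ : OrderComplex P → C(unitInterval, OrderComplex P) := fun w ↦ ⟨H w, hH w⟩
  have hΦ : Continuous Φ := by
    refine continuous_iff.2 fun n σ ↦ ?_
    exact (ContinuousMap.curry ⟨_, hpush n σ⟩).continuous
  have hHu : Continuous fun z : unitInterval × OrderComplex P ↦ H z.2 z.1 :=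
    (ContinuousMap.continuous_uncurry_of_continuous ⟨Φ, hΦ⟩).comp continuous_swap
  refine (contractible_iff_id_nullhomotopic _).2 ⟨y, ⟨⟨⟨_, hHu⟩, fun w ↦ ?_, fun w ↦ ?_⟩⟩⟩
  · exact (Hs _).map_zero w
  · exact (Hs _).map_one w

end OrderComplex

namespace CosetPoset

variable {G : Type} [Group G]

/-- The family of proper normal subgroups of finite index. -/
abbrev properNormal (G : Type) [Group G] : Set (Subgroup G) :=
  {N : Subgroup G | N.Normal ∧ N ≠ ⊤ ∧ N.FiniteIndex}

/-- The maximal elements among the proper normal subgroups of finite index. -/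
abbrev maximalNormal (G : Type) [Group G] : Set (Subgroup G) :=
  {M : Subgroup G | M.Normal ∧ M ≠ ⊤ ∧ M.FiniteIndex ∧
      ∀ N : Subgroup G, N.Normal → N ≠ ⊤ → N.FiniteIndex → M ≤ N → N = M}

lemma mem_smul_subgroup {H : Subgroup G} {g x : G} : x ∈ g • (H : Set G) ↔ g⁻¹ * x ∈ H := by
  rw [Set.mem_smul_set_iff_inv_smul_mem]
  rfl

lemma sup_eq_top {H M : Subgroup G} (hM : M ∈ maximalNormal G) (hH : H.Normal) (h : ¬ H ≤ M) :
    H ⊔ M = ⊤ := by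
  obtain ⟨h1, -, h3, h4⟩ := hM
  by_contra h'
  have := h4 (H ⊔ M) inferInstance h' (Subgroup.finiteIndex_of_le le_sup_right) le_sup_right
  exact h (this ▸ le_sup_left)

/-- Cosets of a subgroup meeting all cosets of a maximal one. -/
lemma exists_inf_coset {H M : Subgroup G} (hM : M ∈ maximalNormal G) (hH : H.Normal)
    (h : ¬ H ≤ M) (g g' : G) : ∃ x, x ∈ g • (H : Set G) ∧ x ∈ g' • (M : Set G) := by
  have := hM.1
  have h1 : g⁻¹ * g' ∈ H ⊔ M := by rw [sup_eq_top hM hH h]; trivial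
  obtain ⟨a, ha, b, hb, hab⟩ := Subgroup.mem_sup_of_normal_right.1 h1
  refine ⟨g * a, mem_smul_subgroup.2 (by simpa using ha), mem_smul_subgroup.2 ?_⟩
  have : g'⁻¹ * (g * a) = b⁻¹ := by
    rw [eq_inv_iff_mul_eq_one, mul_assoc, mul_assoc, hab]
    group
  rw [this]
  exact M.inv_mem hb

lemma smul_inter_smul {H M : Subgroup G} {g g' x : G} (hx : x ∈ g • (H : Set G))
    (hx' : x ∈ g' • (M : Set G)) :
    g • (H : Set G) ∩ g' • (M : Set G) = x • ((H ⊓ M : Subgroup G) : Set G) := by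
  rw [mem_smul_subgroup] at hx hx'
  ext y
  simp only [Set.mem_inter_iff, mem_smul_subgroup, Subgroup.mem_inf]
  refine and_congr ?_ ?_
  · rw [← H.mul_mem_cancel_left hx (y := x⁻¹ * y), mul_assoc, mul_inv_cancel_left]
  · rw [← M.mul_mem_cancel_left hx' (y := x⁻¹ * y), mul_assoc, mul_inv_cancel_left]

lemma finite_setOf_ge (H : Subgroup G) [H.Normal] [H.FiniteIndex] : {M | H ≤ M}.Finite := by
  refine (Set.finite_range (Subgroup.comap (QuotientGroup.mk' H))).subset fun M hM ↦
    ⟨M.map (QuotientGroup.mk' H), ?_⟩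
  rw [Subgroup.comap_map_eq, QuotientGroup.ker_mk', sup_eq_left]
  exact hM

lemma exists_cone (h : (maximalNormal G).Infinite) (Q : Finset (CosetPoset G (properNormal G))) :
    ∃ (f : CosetPoset G (properNormal G) → CosetPoset G (properNormal G))
      (m : CosetPoset G (properNormal G)), (∀ p ∈ Q, ∀ q ∈ Q, p ≤ q → f p ≤ f q) ∧
      (∀ q ∈ Q, f q ≤ q) ∧ ∀ q ∈ Q, f q ≤ m := by
  choose H hH g hg using fun q : CosetPoset G (properNormal G) ↦ q.2
  have hfin : (⋃ q ∈ Q, {M | H q ≤ M}).Finite := Q.finite_toSet.biUnion fun q _ ↦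
    have := (hH q).1
    have := (hH q).2.2
    finite_setOf_ge (H q)
  obtain ⟨M, hM, hMQ⟩ := h.exists_notMem_finite hfin
  have hMQ : ∀ q ∈ Q, ¬ H q ≤ M := by simpa using hMQ
  have key : ∀ q, ∃ q' : CosetPoset G (properNormal G), q ∈ Q → q'.1 = q.1 ∩ M := by
    intro q
    by_cases hq : q ∈ Q
    · obtain ⟨x, hx, hx'⟩ := exists_inf_coset hM (hH q).1 (hMQ q hq) (g q) 1
      have := (hH q).1
      have := (hH q).2.2
      have := hM.1
      have := hM.2.2.1
      refine ⟨⟨x • ((H q ⊓ M : Subgroup G) : Set G), H q ⊓ M, ⟨inferInstance, fun h ↦ ?_,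
        inferInstance⟩, x, rfl⟩, fun _ ↦ ?_⟩
      · exact (hH q).2.1 (top_le_iff.1 (h ▸ inf_le_left))
      · have := (smul_inter_smul hx hx').symm
        rwa [one_smul, ← hg q] at this
    · exact ⟨q, fun h ↦ absurd h hq⟩
  choose f hf using key
  refine ⟨f, ⟨M, M, ⟨hM.1, hM.2.1, hM.2.2.1⟩, 1, (one_smul _ _).symm⟩, fun p hp q hq hpq ↦ ?_,
    fun q hq ↦ ?_, fun q hq ↦ ?_⟩
  · change (f p).1 ⊆ (f q).1
    rw [hf p hp, hf q hq]
    exact Set.inter_subset_inter_left _ hpq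
  · change (f q).1 ⊆ q.1
    rw [hf q hq]
    exact Set.inter_subset_left
  · change (f q).1 ⊆ M
    rw [hf q hq]
    exact Set.inter_subset_right

end CosetPoset

/-! ### Kuhn's form of Sperner's lemma on the cubical grid, by chains modulo two -/

namespace Kuhn

/-- Chains modulo two on ordered lists of grid points. -/
abbrev Chain : Type := List (ℕ → ℕ) →₀ ZMod 2

/-- The cone operator. -/
noncomputable def cone (a : ℕ → ℕ) : Chain →ₗ[ZMod 2] Chain :=
  Finsupp.lmapDomain (ZMod 2) (ZMod 2) (List.cons a)

/-- Translation by `m` in direction `k`. -/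
noncomputable def shift (k m : ℕ) : Chain →ₗ[ZMod 2] Chain :=
  Finsupp.lmapDomain (ZMod 2) (ZMod 2) (List.map (· + Pi.single k m))

/-- The boundary of a list. -/
noncomputable def listBoundary : List (ℕ → ℕ) → Chain
  | [] => 0
  | a :: l => Finsupp.single l 1 + cone a (listBoundary l)

/-- The boundary operator. -/
noncomputable def boundary : Chain →ₗ[ZMod 2] Chain :=
  Finsupp.linearCombination (ZMod 2) listBoundary

/-- The prism between a list and its unit translate in direction `k`. -/
noncomputable def listPrism (k : ℕ) : List (ℕ → ℕ) → Chain
  | [] => 0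
  | a :: l => Finsupp.single (a :: (a :: l).map (· + Pi.single k 1)) 1 + cone a (listPrism k l)

/-- The prism operator. -/
noncomputable def prism (k : ℕ) : Chain →ₗ[ZMod 2] Chain :=
  Finsupp.linearCombination (ZMod 2) (listPrism k)

@[simp] lemma cone_single (a : ℕ → ℕ) (l : List (ℕ → ℕ)) (c : ZMod 2) :
    cone a (Finsupp.single l c) = Finsupp.single (a :: l) c := by
  simp [cone]

@[simp] lemma shift_single (k m : ℕ) (l : List (ℕ → ℕ)) (c : ZMod 2) :
    shift k m (Finsupp.single l c) = Finsupp.single (l.map (· + Pi.single k m)) c := by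
  simp [shift]

@[simp] lemma boundary_single (l : List (ℕ → ℕ)) :
    boundary (Finsupp.single l 1) = listBoundary l := by
  simp [boundary]

@[simp] lemma prism_single (k : ℕ) (l : List (ℕ → ℕ)) :
    prism k (Finsupp.single l 1) = listPrism k l := by
  simp [prism]

lemma boundary_cone (a : ℕ → ℕ) (x : Chain) :
    boundary (cone a x) = x + cone a (boundary x) := by
  suffices h : boundary ∘ₗ cone a = LinearMap.id + cone a ∘ₗ boundary from
    LinearMap.congr_fun h x
  ext l : 2
  simp [listBoundary]

lemma shift_cone (k m : ℕ) (a : ℕ → ℕ) (x : Chain) :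
    shift k m (cone a x) = cone (a + Pi.single k m) (shift k m x) := by
  suffices h : shift k m ∘ₗ cone a = cone (a + Pi.single k m) ∘ₗ shift k m from
    LinearMap.congr_fun h x
  ext l : 2
  simp

lemma prism_cone (k : ℕ) (a : ℕ → ℕ) (x : Chain) :
    prism k (cone a x) =
      cone a (cone (a + Pi.single k 1) (shift k 1 x)) + cone a (prism k x) := by
  suffices h : prism k ∘ₗ cone a =
      cone a ∘ₗ cone (a + Pi.single k 1) ∘ₗ shift k 1 + cone a ∘ₗ prism k from
    LinearMap.congr_fun h x
  ext l : 2
  simp [listPrism]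

lemma boundary_shift (k m : ℕ) (x : Chain) :
    boundary (shift k m x) = shift k m (boundary x) := by
  suffices h : boundary ∘ₗ shift k m = shift k m ∘ₗ boundary from LinearMap.congr_fun h x
  ext l : 2
  suffices h : listBoundary (l.map (· + Pi.single k m)) = shift k m (listBoundary l) by simpa
  induction l with
  | nil => simp [listBoundary]
  | cons a l ih => simp [listBoundary, ih, shift_cone]

lemma boundary_prism (k : ℕ) (x : Chain) :
    boundary (prism k x) = shift k 1 x + x + prism k (boundary x) := by
  suffices h : boundary ∘ₗ prism k = shift k 1 + LinearMap.id + prism k ∘ₗ boundary from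
    LinearMap.congr_fun h x
  ext l : 2
  suffices h : boundary (listPrism k l) = Finsupp.single (l.map (· + Pi.single k 1)) 1 +
      Finsupp.single l 1 + prism k (listBoundary l) by simpa
  induction l with
  | nil => simp [listPrism, listBoundary, ZModModule.add_self]
  | cons a l ih =>
    have h := boundary_shift k 1 (Finsupp.single l 1)
    simp only [shift_single, boundary_single] at h
    simp only [listPrism, listBoundary, map_add, boundary_single, boundary_cone, prism_cone,
      prism_single, List.map_cons, ih, h, cone_single]
    have e : (Finsupp.single (a :: l.map (· + Pi.single k 1)) 1 : Chain) +
      Finsupp.single (a :: l.map (· + Pi.single k 1)) 1 = 0 := ZModModule.add_self _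
    linear_combination (norm := abel) e

lemma shift_shift (k m m' : ℕ) (x : Chain) : shift k m (shift k m' x) = shift k (m + m') x := by
  suffices h : shift k m ∘ₗ shift k m' = shift k (m + m') from LinearMap.congr_fun h x
  ext l : 2
  simp [Function.comp_def, add_assoc, ← Pi.single_add, add_comm m']

lemma shift_zero (k : ℕ) (x : Chain) : shift k 0 x = x := by
  suffices h : shift k 0 = LinearMap.id from LinearMap.congr_fun h x
  ext l : 2
  simp

/-- The slab of height `n` over a chain, in direction `k`. -/
noncomputable def slab (n k : ℕ) (x : Chain) : Chain :=
  ∑ m ∈ Finset.range n, shift k m (prism k x)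

lemma slab_add (n k : ℕ) (x y : Chain) : slab n k (x + y) = slab n k x + slab n k y := by
  simp [slab, Finset.sum_add_distrib]

lemma boundary_slab (n k : ℕ) (x : Chain) :
    boundary (slab n k x) = x + (shift k n x + slab n k (boundary x)) := by
  induction n with
  | zero => simp [slab, shift_zero, ZModModule.add_self]
  | succ n ih =>
    simp only [slab, Finset.sum_range_succ, map_add] at ih ⊢
    rw [ih, boundary_shift, boundary_prism, map_add, map_add, shift_shift]
    have e : shift k n x + shift k n x = 0 := ZModModule.add_self _
    calc _ = x + (shift k (n + 1) x + (∑ m ∈ Finset.range n, shift k m (prism k (boundary x)) +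
          shift k n (prism k (boundary x)))) + (shift k n x + shift k n x) := by abel
      _ = _ := by rw [e, add_zero]

/-- Lists all of whose entries arise from `l` by a step of height `m` in direction `k`. -/
def IsStep (k m : ℕ) (l l' : List (ℕ → ℕ)) : Prop :=
  l'.length = l.length + 1 ∧ ∀ v' ∈ l', ∃ v ∈ l, v' = v + Pi.single k m ∨
    v' = v + Pi.single k (m + 1)

lemma cone_mem {A B : Set (List (ℕ → ℕ))} {a : ℕ → ℕ} {x : Chain}
    (hx : x ∈ Finsupp.supported (ZMod 2) (ZMod 2) A) (h : ∀ l ∈ A, a :: l ∈ B) :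
    cone a x ∈ Finsupp.supported (ZMod 2) (ZMod 2) B := by
  classical
  intro l hl
  obtain ⟨l', hl', rfl⟩ := Finset.mem_image.1 (Finsupp.mapDomain_support hl)
  exact h l' (hx hl')

lemma shift_mem {A B : Set (List (ℕ → ℕ))} {k m : ℕ} {x : Chain}
    (hx : x ∈ Finsupp.supported (ZMod 2) (ZMod 2) A)
    (h : ∀ l ∈ A, l.map (· + Pi.single k m) ∈ B) :
    shift k m x ∈ Finsupp.supported (ZMod 2) (ZMod 2) B := by
  classical
  intro l hl
  obtain ⟨l', hl', rfl⟩ := Finset.mem_image.1 (Finsupp.mapDomain_support hl)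
  exact h l' (hx hl')

lemma listPrism_mem (k : ℕ) (l : List (ℕ → ℕ)) :
    listPrism k l ∈ Finsupp.supported (ZMod 2) (ZMod 2) {l' | IsStep k 0 l l'} := by
  induction l with
  | nil => exact zero_mem _
  | cons a l ih =>
    refine add_mem (Finsupp.single_mem_supported _ _ ⟨by simp, ?_⟩) (cone_mem ih ?_)
    · intro v' hv'
      rcases List.mem_cons.1 hv' with rfl | hv'
      · exact ⟨v', by simp, by simp⟩
      · obtain ⟨v, hv, rfl⟩ := List.mem_map.1 hv'
        exact ⟨v, hv, by simp⟩
    · rintro l' ⟨h1, h2⟩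
      refine ⟨by simp [h1], fun v' hv' ↦ ?_⟩
      rcases List.mem_cons.1 hv' with rfl | hv'
      · exact ⟨v', by simp, by simp⟩
      · obtain ⟨v, hv, h⟩ := h2 v' hv'
        exact ⟨v, List.mem_cons_of_mem _ hv, h⟩

lemma slab_mem {A B : Set (List (ℕ → ℕ))} {n k : ℕ} {x : Chain}
    (hx : x ∈ Finsupp.supported (ZMod 2) (ZMod 2) A)
    (h : ∀ l ∈ A, ∀ m l', IsStep k m l l' → l' ∈ B) :
    slab n k x ∈ Finsupp.supported (ZMod 2) (ZMod 2) B := by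
  refine sum_mem fun m _ ↦ ?_
  refine shift_mem (A := {l' | ∃ l ∈ A, IsStep k 0 l l'}) ?_ ?_
  · rw [prism, Finsupp.linearCombination_apply]
    refine sum_mem fun l hl ↦ Submodule.smul_mem _ _ ?_
    refine Finsupp.supported_mono ?_ (listPrism_mem k l)
    exact fun l' hl' ↦ ⟨l, hx hl, hl'⟩
  · rintro l' ⟨l, hl, h1, h2⟩
    refine h l hl m _ ⟨by simpa using h1, fun v' hv' ↦ ?_⟩
    obtain ⟨w, hw, rfl⟩ := List.mem_map.1 hv'
    obtain ⟨v, hv, rfl | rfl⟩ := h2 w hw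
    · exact ⟨v, hv, by simp⟩
    · exact ⟨v, hv, Or.inr (by rw [add_assoc, ← Pi.single_add, zero_add, add_comm 1])⟩

/-- The Kuhn triangulation of the `k`-dimensional cube of side `n`, as a chain. -/
noncomputable def cube (n : ℕ) : ℕ → Chain
  | 0 => Finsupp.single [0] 1
  | k + 1 => slab n k (cube n k)

/-- Small lists of the right dimension inside the `k`-dimensional grid. -/
def Small (k : ℕ) (l : List (ℕ → ℕ)) : Prop :=
  l.length = k + 1 ∧ (∀ v ∈ l, ∀ i, k ≤ i → v i = 0) ∧ ∀ v ∈ l, ∀ w ∈ l, ∀ i, v i ≤ w i + 1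

/-- Lists inside a facet of the `k`-dimensional cube other than the last bottom facet. -/
def InFacet (n k : ℕ) (l : List (ℕ → ℕ)) : Prop :=
  ∃ i, (i < k ∧ ∀ v ∈ l, v i = n) ∨ (i + 1 < k ∧ ∀ v ∈ l, v i = 0)

lemma cube_mem (n k : ℕ) : cube n k ∈ Finsupp.supported (ZMod 2) (ZMod 2) {l | Small k l} := by
  induction k with
  | zero =>
    refine Finsupp.single_mem_supported _ _ ⟨rfl, ?_, ?_⟩ <;> simp
  | succ k ih =>
    refine slab_mem ih ?_
    rintro l ⟨h1, h2, h3⟩ m l' ⟨h1', h2'⟩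
    refine ⟨by rw [h1', h1], fun v' hv' i hi ↦ ?_, fun v' hv' w' hw' i ↦ ?_⟩
    · obtain ⟨v, hv, rfl | rfl⟩ := h2' v' hv' <;>
        simp [h2 v hv i (by lia), show i ≠ k by lia]
    · obtain ⟨v, hv, hv'⟩ := h2' v' hv'
      obtain ⟨w, hw, hw'⟩ := h2' w' hw'
      by_cases hi : i = k
      · subst hi
        have h4 := h2 v hv i le_rfl
        have h5 := h2 w hw i le_rfl
        rcases hv' with rfl | rfl <;> rcases hw' with rfl | rfl <;> simp [h4, h5]
        lia
      · have := h3 v hv w hw i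
        rcases hv' with rfl | rfl <;> rcases hw' with rfl | rfl <;>
          simpa [Pi.single_apply, hi] using this

lemma exists_boundary_cube (n k : ℕ) : ∃ W, boundary (cube n (k + 1)) = cube n k + W ∧
    W ∈ Finsupp.supported (ZMod 2) (ZMod 2) {l | InFacet n (k + 1) l} := by
  have hshift : ∀ k, shift k n (cube n k) ∈
      Finsupp.supported (ZMod 2) (ZMod 2) {l | InFacet n (k + 1) l} := by
    intro k
    refine shift_mem (cube_mem n k) ?_
    rintro l ⟨-, h2, -⟩
    refine ⟨k, Or.inl ⟨by lia, fun v hv ↦ ?_⟩⟩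
    obtain ⟨w, hw, rfl⟩ := List.mem_map.1 hv
    simp [h2 w hw k le_rfl]
  induction k with
  | zero =>
    refine ⟨_, boundary_slab n 0 _, add_mem (hshift 0) (slab_mem (A := {[]}) ?_ ?_)⟩
    · rw [cube, boundary_single, listBoundary, listBoundary, map_zero, add_zero]
      exact Finsupp.single_mem_supported _ _ rfl
    · rintro l rfl m l' ⟨h, h'⟩
      obtain ⟨v, hv⟩ := List.exists_mem_of_length_pos (l := l') (by lia)
      obtain ⟨w, hw, -⟩ := h' v hv
      simp at hw
  | succ k ih =>
    obtain ⟨W, hW, hW'⟩ := ih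
    refine ⟨_, boundary_slab n (k + 1) _, add_mem (hshift _) ?_⟩
    rw [hW, slab_add]
    refine add_mem (slab_mem (cube_mem n k) ?_) (slab_mem hW' ?_)
    · rintro l ⟨-, h2, -⟩ m l' ⟨-, h'⟩
      refine ⟨k, Or.inr ⟨by lia, fun v' hv' ↦ ?_⟩⟩
      obtain ⟨v, hv, rfl | rfl⟩ := h' v' hv' <;> simp [h2 v hv k le_rfl]
    · rintro l ⟨i, hi⟩ m l' ⟨-, h'⟩
      have key : ∀ v' ∈ l', ∃ v ∈ l, v' i = v i := by
        intro v' hv'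
        have hik : i ≠ k + 1 := by lia
        obtain ⟨v, hv, rfl | rfl⟩ := h' v' hv' <;>
          exact ⟨v, hv, by simp [hik]⟩
      refine ⟨i, hi.imp (fun h ↦ ⟨by lia, fun v' hv' ↦ ?_⟩) fun h ↦ ⟨by lia, fun v' hv' ↦ ?_⟩⟩ <;>
      · obtain ⟨v, hv, e⟩ := key v' hv'
        rw [e, h.2 v hv]

section labels

variable (lab : (ℕ → ℕ) → ℕ)

/-- Evaluation of a function of the labels on chains. -/
noncomputable def eval (φ : Multiset ℕ → ZMod 2) : Chain →ₗ[ZMod 2] ZMod 2 :=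
  Finsupp.linearCombination (ZMod 2) fun l ↦ φ (l.map lab)

@[simp] lemma eval_single (φ : Multiset ℕ → ZMod 2) (l : List (ℕ → ℕ)) :
    eval lab φ (Finsupp.single l 1) = φ (l.map lab) := by
  simp [eval]

lemma eval_cone (φ : Multiset ℕ → ZMod 2) (a : ℕ → ℕ) (x : Chain) :
    eval lab φ (cone a x) = eval lab (fun s ↦ φ (lab a ::ₘ s)) x := by
  suffices h : eval lab φ ∘ₗ cone a = eval lab (fun s ↦ φ (lab a ::ₘ s)) from
    LinearMap.congr_fun h x
  ext l : 2
  simp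

lemma eval_listBoundary (φ : Multiset ℕ → ZMod 2) (l : List (ℕ → ℕ)) :
    eval lab φ (listBoundary l) =
      ((l.map lab : Multiset ℕ).map fun b ↦ φ ((l.map lab : Multiset ℕ).erase b)).sum := by
  induction l generalizing φ with
  | nil => simp [listBoundary]
  | cons a l ih =>
    rw [listBoundary, map_add, eval_single, eval_cone, ih, List.map_cons, ← Multiset.cons_coe,
      Multiset.map_cons, Multiset.sum_cons, Multiset.erase_cons_head]
    congr 2
    refine Multiset.map_congr rfl fun b hb ↦ ?_
    rw [Multiset.erase_cons_tail_of_mem hb]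

lemma sum_erase_eq (k : ℕ) (s : Multiset ℕ) (hs : ∀ b ∈ s, b ≤ k + 1) :
    (s.map fun b ↦ if s.erase b = Multiset.range (k + 1) then (1 : ZMod 2) else 0).sum =
      if s = Multiset.range (k + 2) then 1 else 0 := by
  by_cases h : ∃ b ∈ s, s.erase b = Multiset.range (k + 1)
  · obtain ⟨b, hb, hb'⟩ := h
    have hs' : s = b ::ₘ Multiset.range (k + 1) := by rw [← hb', Multiset.cons_erase hb]
    have h1 : ∀ c ∈ s, s.erase c = Multiset.range (k + 1) ↔ b = c := by
      refine fun c hc ↦ ⟨fun h ↦ ?_, fun h ↦ h ▸ hb'⟩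
      rw [← Multiset.cons_inj_left (Multiset.range (k + 1)), ← hs', ← h, Multiset.cons_erase hc]
    have h2 : s = Multiset.range (k + 2) ↔ b = k + 1 := by
      rw [hs', Multiset.range_succ (k + 1), Multiset.cons_inj_left]
    have h3 : ((Multiset.range (k + 1)).map fun c ↦ if b = c then (1 : ZMod 2) else 0).sum =
        if b ∈ Finset.range (k + 1) then 1 else 0 := 
      Finset.sum_ite_eq (Finset.range (k + 1)) b fun _ ↦ 1
    have h4 := hs b hb
    rw [Multiset.map_congr rfl fun c hc ↦ if_congr (h1 c hc) rfl rfl, if_congr h2 rfl rfl, hs',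
      Multiset.map_cons, Multiset.sum_cons, if_pos rfl, h3]
    by_cases h5 : b = k + 1
    · simp [h5]
    · rw [if_pos (Finset.mem_range.2 (by lia)), if_neg h5]
      exact CharTwo.add_self_eq_zero 1
  · push Not at h
    rw [Multiset.map_congr rfl fun c hc ↦ if_neg (h c hc), if_neg]
    · simp
    · rintro rfl
      refine h (k + 1) (by simp) ?_
      rw [Multiset.range_succ (k + 1), Multiset.erase_cons_head]

end labels

/-- **Kuhn's lemma.** -/
theorem exists_small (n r : ℕ) (lab : (ℕ → ℕ) → ℕ) (hr : ∀ v, lab v ≤ r)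
    (h0 : ∀ v, ∀ i < r, v i = 0 → lab v ≠ i + 1) (h1 : ∀ v, ∀ i < r, v i = n → i + 1 ≤ lab v) :
    ∃ l : List (ℕ → ℕ), (∀ v ∈ l, ∀ w ∈ l, ∀ i, v i ≤ w i + 1) ∧ ∀ j ≤ r, ∃ v ∈ l, lab v = j := by
  classical
  let φ (k : ℕ) (s : Multiset ℕ) : ZMod 2 := if s = Multiset.range (k + 1) then 1 else 0
  have hev : ∀ {A : Set (List (ℕ → ℕ))} {x : Chain} {f g : Chain →ₗ[ZMod 2] ZMod 2},
      x ∈ Finsupp.supported (ZMod 2) (ZMod 2) A →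
      (∀ l ∈ A, f (Finsupp.single l 1) = g (Finsupp.single l 1)) → f x = g x := by
    intro A x f g hx h
    rw [Finsupp.supported_eq_span_single] at hx
    refine LinearMap.eqOn_span ?_ hx
    rintro _ ⟨l, hl, rfl⟩
    exact h l hl
  have key : ∀ k ≤ r, eval lab (φ k) (cube n k) = 1 := by
    intro k hk
    induction k with
    | zero =>
      have : lab 0 = 0 := by
        by_contra h
        exact h0 0 (lab 0 - 1) (by have := hr 0; lia) rfl (by lia)
      simp [cube, φ, this]
    | succ k ih =>
      obtain ⟨W, hW, hW'⟩ := exists_boundary_cube n k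
      have e1 : eval lab (φ k) W = 0 := by
        refine hev (g := 0) hW' ?_
        rintro l ⟨i, hi⟩
        rw [eval_single, LinearMap.zero_apply]
        refine if_neg fun h ↦ ?_
        have hmem : ∀ j < k + 1, ∃ v ∈ l, lab v = j := fun j hj ↦ by
          have : j ∈ (l.map lab : Multiset ℕ) := h ▸ Multiset.mem_range.2 hj
          simpa using this
        rcases hi with ⟨hi, h'⟩ | ⟨hi, h'⟩
        · obtain ⟨v, hv, hv'⟩ := hmem 0 (by lia)
          have := h1 v i (by lia) (h' v hv)
          lia
        · obtain ⟨v, hv, hv'⟩ := hmem (i + 1) (by lia)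
          exact h0 v i (by lia) (h' v hv) hv'
      have e2 : eval lab (φ (k + 1)) (cube n (k + 1)) =
          (eval lab (φ k) ∘ₗ boundary) (cube n (k + 1)) := by
        refine hev (cube_mem n (k + 1)) ?_
        rintro l ⟨-, hl, -⟩
        rw [LinearMap.comp_apply, boundary_single, eval_single, eval_listBoundary]
        refine (sum_erase_eq k _ fun b hb ↦ ?_).symm
        obtain ⟨v, hv, rfl⟩ := List.mem_map.1 (Multiset.mem_coe.1 hb)
        by_contra hlt
        have := hr v
        exact h0 v (lab v - 1) (by lia) (hl v hv _ (by lia)) (by lia)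
      rw [e2, LinearMap.comp_apply, hW, map_add, e1, add_zero, ih (by lia)]
  by_contra! hcon
  have : eval lab (φ r) (cube n r) = 0 := by
    refine hev (g := 0) (cube_mem n r) ?_
    rintro l ⟨-, -, hl⟩
    rw [eval_single, LinearMap.zero_apply]
    refine if_neg fun h ↦ ?_
    obtain ⟨j, hj, hj'⟩ := hcon l hl
    have : j ∈ (l.map lab : Multiset ℕ) := h ▸ Multiset.mem_range.2 (by lia)
    obtain ⟨v, hv, hv'⟩ := List.mem_map.1 (Multiset.mem_coe.1 this)
    exact hj' v hv hv'
  rw [key r le_rfl] at this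
  exact one_ne_zero this

end Kuhn

namespace Kuhn

variable {r : ℕ}

/-- The point of the cube with the given grid coordinates. -/
noncomputable def gridPoint (r n : ℕ) (v : ℕ → ℕ) : Metric.closedBall (0 : Fin r → ℝ) 1 :=
  ⟨fun i ↦ 2 * (min (v i) (n + 1) : ℕ) / (n + 1) - 1, by
    rw [mem_closedBall_zero_iff, pi_norm_le_iff_of_nonneg zero_le_one]
    intro i
    have h1 : ((min (v i) (n + 1) : ℕ) : ℝ) ≤ n + 1 := by exact_mod_cast min_le_right _ _
    have h2 : (0 : ℝ) < n + 1 := by positivity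
    rw [Real.norm_eq_abs, abs_le]
    constructor
    · linarith [show (0 : ℝ) ≤ 2 * (min (v i) (n + 1) : ℕ) / (n + 1) by positivity]
    · rw [sub_le_iff_le_add, div_le_iff₀ h2]
      linarith⟩

lemma dist_gridPoint_le {n : ℕ} {v w : ℕ → ℕ} (h : ∀ i, v i ≤ w i + 1) (h' : ∀ i, w i ≤ v i + 1) :
    dist (gridPoint r n v) (gridPoint r n w) ≤ 2 / ((n : ℝ) + 1) := by
  have h2 : (0 : ℝ) < n + 1 := by positivity
  refine (dist_pi_le_iff (by positivity)).2 fun i ↦ ?_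
  have e1 : min (v i) (n + 1) ≤ min (w i) (n + 1) + 1 := by have := h i; lia
  have e2 : min (w i) (n + 1) ≤ min (v i) (n + 1) + 1 := by have := h' i; lia
  have e1' : ((min (v i) (n + 1) : ℕ) : ℝ) ≤ (min (w i) (n + 1) : ℕ) + 1 := by exact_mod_cast e1
  have e2' : ((min (w i) (n + 1) : ℕ) : ℝ) ≤ (min (v i) (n + 1) : ℕ) + 1 := by exact_mod_cast e2
  simp only [gridPoint]
  rw [Real.dist_eq, sub_sub_sub_cancel_right, ← sub_div, abs_div, abs_of_pos h2]
  gcongr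
  rw [abs_le]
  constructor <;> linarith

/-- A cubical form of the Knaster–Kuratowski–Mazurkiewicz lemma. -/
theorem exists_mem_forall {C : ℕ → Set (Metric.closedBall (0 : Fin r → ℝ) 1)}
    (hC : ∀ j, IsClosed (C j)) (hcov : ∀ x, ∃ j ≤ r, x ∈ C j)
    (h0 : ∀ x, ∀ i : Fin r, x.1 i = -1 → x ∉ C (i + 1))
    (h1 : ∀ x, ∀ i : Fin r, x.1 i = 1 → ∀ j ≤ (i : ℕ), x ∉ C j) : ∃ x, ∀ j ≤ r, x ∈ C j := by
  choose c hcr hc using hcov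
  have key : ∀ n : ℕ, ∃ v : ℕ → ℕ → ℕ, (∀ j j', j ≤ r → j' ≤ r → ∀ i, v j i ≤ v j' i + 1) ∧
      ∀ j ≤ r, gridPoint r n (v j) ∈ C j := by
    intro n
    have hn : ((n : ℝ) + 1) ≠ 0 := by positivity
    obtain ⟨l, hl, hl'⟩ := exists_small (n + 1) r (fun v ↦ c (gridPoint r n v)) (fun v ↦ hcr _)
      (fun v i hi hv h ↦ h0 _ ⟨i, hi⟩ (by
        simp [gridPoint, hv, n.cast_add_one_pos.le]) (h ▸ hc _))
      (fun v i hi hv ↦ by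
        by_contra! hlt
        refine h1 (gridPoint r n v) ⟨i, hi⟩ ?_ _ (Nat.lt_succ_iff.1 hlt) (hc _)
        simp [gridPoint, hv]
        field_simp
        norm_num)
    choose! v hv hv' using hl'
    exact ⟨v, fun j j' hj hj' ↦ hl _ (hv j hj) _ (hv j' hj'), fun j hj ↦ by
      have := hc (gridPoint r n (v j))
      rwa [hv' j hj] at this⟩
  choose v hv hv' using key
  obtain ⟨x, -, φ, hφ, hx⟩ := isCompact_univ.tendsto_subseq fun n ↦
    Set.mem_univ (gridPoint r n (v n 0))
  refine ⟨x, fun j hj ↦ ?_⟩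
  refine (hC j).mem_of_tendsto (b := Filter.atTop) (f := fun n ↦ gridPoint r (φ n) (v (φ n) j)) ?_
    (Filter.Eventually.of_forall fun n ↦ hv' (φ n) j hj)
  refine hx.congr_dist (squeeze_zero (fun _ ↦ dist_nonneg) (fun n ↦ dist_gridPoint_le
    (hv _ _ _ (Nat.zero_le r) hj) (hv _ _ _ hj (Nat.zero_le r))) ?_)
  have : Filter.Tendsto (fun n : ℕ ↦ 2 * (1 / ((n : ℝ) + 1))) Filter.atTop (nhds (2 * 0)) :=
    tendsto_one_div_add_atTop_nhds_zero_nat.const_mul 2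
  simp only [mul_zero, mul_one_div] at this
  exact this.comp hφ.tendsto_atTop

end Kuhn

/-! ### Colourings obstructing contractibility -/

namespace SignVector

variable {r : ℕ}

/-- A product which is positive exactly when the sign vector `e` is a truncation of `x`. -/
noncomputable def weight (e : Fin r → SignType) (x : Fin r → ℝ) : ℝ :=
  (∏ i, ∏ k, if e i ≠ 0 ∧ e k = 0 then max 0 ((e i : ℝ) * x i - |x k|) else 1) *
    ∏ i, if e i ≠ 0 then max 0 ((e i : ℝ) * x i) else 1

lemma weight_nonneg (e : Fin r → SignType) (x : Fin r → ℝ) : 0 ≤ weight e x := by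
  refine mul_nonneg (Finset.prod_nonneg fun i _ ↦ Finset.prod_nonneg fun k _ ↦ ?_)
    (Finset.prod_nonneg fun i _ ↦ ?_) <;> split_ifs <;> simp

lemma continuous_weight (e : Fin r → SignType) : Continuous (weight e) := by
  refine .mul (continuous_finsetProd _ fun i _ ↦ continuous_finsetProd _ fun k _ ↦ ?_)
    (continuous_finsetProd _ fun i _ ↦ ?_) <;> split_ifs <;> fun_prop

lemma weight_ne_zero_iff {e : Fin r → SignType} {x : Fin r → ℝ} : weight e x ≠ 0 ↔
    (∀ i k, e i ≠ 0 → e k = 0 → |x k| < (e i : ℝ) * x i) ∧ ∀ i, e i ≠ 0 → 0 < (e i : ℝ) * x i := by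
  have hmax (a : ℝ) : max 0 a ≠ 0 ↔ 0 < a := by
    rw [ne_eq, max_eq_left_iff, not_le]
  simp only [weight, mul_ne_zero_iff, Finset.prod_ne_zero_iff, Finset.mem_univ, true_imp_iff]
  refine and_congr (forall_congr' fun i ↦ forall_congr' fun k ↦ ?_) (forall_congr' fun i ↦ ?_)
  · split_ifs with h
    · simp [hmax, h]
    · simp only [ne_eq, one_ne_zero, not_false_eq_true, true_iff]
      exact fun h1 h2 ↦ absurd ⟨h1, h2⟩ h
  · split_ifs with h
    · simp [hmax, h]
    · simp [h]

lemma abs_eq_of_pos {s : SignType} {a : ℝ} (h : 0 < (s : ℝ) * a) : (s : ℝ) * a = |a| := by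
  cases s <;> simp at h ⊢
  · exact (abs_of_neg h).symm
  · exact (abs_of_pos h).symm

lemma eq_of_pos {s s' : SignType} {a : ℝ} (h : 0 < (s : ℝ) * a) (h' : 0 < (s' : ℝ) * a) :
    s = s' := by
  cases s <;> cases s' <;> simp at h h' ⊢ <;> linarith

/-- The sign vector `e'` extends `e`. -/
def Extends (e e' : Fin r → SignType) : Prop := ∀ i, e i ≠ 0 → e' i = e i

lemma extends_or_extends {e e' : Fin r → SignType} {x : Fin r → ℝ} (h : weight e x ≠ 0)
    (h' : weight e' x ≠ 0) : Extends e e' ∨ Extends e' e := by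
  rw [weight_ne_zero_iff] at h h'
  by_contra! hcon
  simp only [Extends, not_forall] at hcon
  obtain ⟨⟨i, hi, hi'⟩, k, hk, hk'⟩ := hcon
  have e1 : e' i = 0 := by
    by_contra h0
    exact hi' (eq_of_pos (h'.2 i h0) (h.2 i hi))
  have e2 : e k = 0 := by
    by_contra h0
    exact hk' (eq_of_pos (h.2 k h0) (h'.2 k hk))
  have h1 := h.1 i k hi e2
  have h2 := h'.1 k i hk e1
  rw [abs_eq_of_pos (h.2 i hi)] at h1
  rw [abs_eq_of_pos (h'.2 k hk)] at h2
  exact lt_asymm h1 h2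

lemma exists_abs_eq_one {x : Fin r → ℝ} (hx : ‖x‖ = 1) : ∃ i, |x i| = 1 := by
  by_contra! h
  have : ‖x‖ < 1 := (pi_norm_lt_iff zero_lt_one).2 fun i ↦
    lt_of_le_of_ne (hx ▸ norm_le_pi_norm x i) (h i)
  exact this.ne hx

lemma exists_weight_ne_zero {x : Fin r → ℝ} (hx : ‖x‖ = 1) : ∃ e, e ≠ 0 ∧ weight e x ≠ 0 := by
  have h0 : ∀ i, |x i| = 1 → SignType.sign (x i) ≠ 0 := fun i hi h ↦ by
    rw [sign_eq_zero_iff.1 h] at hi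
    simp at hi
  have h1 : ∀ i, |x i| ≤ 1 := fun i ↦ hx ▸ norm_le_pi_norm x i
  refine ⟨fun i ↦ if |x i| = 1 then SignType.sign (x i) else 0, fun h ↦ ?_,
    weight_ne_zero_iff.2 ⟨fun i k hi hk ↦ ?_, fun i hi ↦ ?_⟩⟩
  · obtain ⟨i, hi⟩ := exists_abs_eq_one hx
    have := congrFun h i
    simp only [hi, if_true] at this
    exact h0 i hi this
  · have hi' : |x i| = 1 := by by_contra h; simp [h] at hi
    have hk' : |x k| ≠ 1 := fun h ↦ h0 k h (by simpa [h] using hk)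
    simp only [hi', if_true, sign_mul_self]
    exact lt_of_le_of_ne (h1 k) hk'
  · have hi' : |x i| = 1 := by by_contra h; simp [h] at hi
    simp [hi', sign_mul_self]

lemma pos_of_abs_eq_one {e : Fin r → SignType} {x : Fin r → ℝ} (he : e ≠ 0) (hx : ‖x‖ = 1)
    (h : weight e x ≠ 0) {i : Fin r} (hi : |x i| = 1) : 0 < (e i : ℝ) * x i := by
  rw [weight_ne_zero_iff] at h
  refine h.2 i fun h0 ↦ ?_
  obtain ⟨k, hk⟩ := Function.ne_iff.1 he
  have h1 := h.1 k i hk h0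
  rw [abs_eq_of_pos (h.2 k hk), hi] at h1
  exact h1.not_ge (hx ▸ norm_le_pi_norm x k)

end SignVector

namespace OrderComplex

variable {P : Type} [PartialOrder P]

open Classical in
lemma integral_indicator_eq_one_iff {S : Set P} {w : OrderComplex P} :
    integral (S.indicator 1) w = 1 ↔ ∀ p ∈ w.wt.support, p ∈ S := by
  have h : 1 - integral (S.indicator 1) w =
      ∑ p ∈ w.wt.support, w.wt p * (1 - S.indicator 1 p) := by
    simp only [mul_sub, mul_one, Finset.sum_sub_distrib]
    rw [w.sum_eq_one_of_support_subset le_rfl]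
    rfl
  rw [eq_comm, ← sub_eq_zero, h, Finset.sum_eq_zero_iff_of_nonneg]
  · refine forall₂_congr fun p hp ↦ ?_
    rw [mul_eq_zero, or_iff_right (Finsupp.mem_support_iff.1 hp), sub_eq_zero]
    by_cases hS : p ∈ S <;> simp [hS]
  · intro p _
    refine mul_nonneg (w.wt_nonneg p) (sub_nonneg.2 ?_)
    by_cases hS : p ∈ S <;> simp [hS]

lemma exists_le_support (w : OrderComplex P) :
    ∃ p ∈ w.wt.support, ∀ q ∈ w.wt.support, p ≤ q := by
  obtain ⟨p, hp, hmin⟩ := w.wt.support.exists_minimal w.support_nonempty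
  refine ⟨p, hp, fun q hq ↦ ?_⟩
  by_cases hpq : p = q
  · exact hpq.le
  · exact (w.isChain_support hp hq hpq).elim id fun h ↦ hmin hq h

variable {r : ℕ}

open Classical SignVector in
/-- The map from the boundary of the cube given by vertices indexed by sign vectors. -/
lemma exists_boundary_map {p : {e : Fin r → SignType // e ≠ 0} → P}
    (hp : ∀ e e', Extends e.1 e'.1 → p e' ≤ p e) {Z : Type} [TopologicalSpace Z]
    {x : Z → Fin r → ℝ} (hxc : Continuous x) (hx : ∀ z, ‖x z‖ = 1) :
    ∃ f : C(Z, OrderComplex P), ∀ z, ∀ q ∈ (f z).wt.support,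
      ∃ e, p e = q ∧ weight e.1 (x z) ≠ 0 := by
  let s : Z → ℝ := fun z ↦ ∑ e : {e : Fin r → SignType // e ≠ 0}, weight e.1 (x z)
  have hs : ∀ z, s z ≠ 0 := fun z ↦ by
    obtain ⟨e, he, h⟩ := exists_weight_ne_zero (hx z)
    have : 0 < s z := Finset.sum_pos' (fun e _ ↦ weight_nonneg _ _)
      ⟨⟨e, he⟩, Finset.mem_univ _, lt_of_le_of_ne (weight_nonneg _ _) h.symm⟩
    exact this.ne'
  let a : Z → P → ℝ := fun z q ↦ (∑ e with p e = q, weight e.1 (x z)) / s z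
  have ha : ∀ z q, a z q ≠ 0 → ∃ e, p e = q ∧ weight e.1 (x z) ≠ 0 := by
    intro z q h
    obtain ⟨e, he, h⟩ := Finset.exists_ne_zero_of_sum_ne_zero (div_ne_zero_iff.1 h).1
    exact ⟨e, (Finset.mem_filter.1 he).2, h⟩
  let f : Z → OrderComplex P := fun z ↦ mk' (Finset.univ.image p) (a z)
    (fun q _ ↦ div_nonneg (Finset.sum_nonneg fun e _ ↦ weight_nonneg _ _)
      (Finset.sum_nonneg fun e _ ↦ weight_nonneg _ _))
    (by
      simp only [a]
      rw [← Finset.sum_div, Finset.sum_fiberwise_of_maps_to fun e _ ↦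
        Finset.mem_image_of_mem p (Finset.mem_univ e)]
      exact div_self (hs z))
    (fun q _ q' _ hq hq' ↦ by
      obtain ⟨e, rfl, he⟩ := ha z q hq
      obtain ⟨e', rfl, he'⟩ := ha z q' hq'
      exact (extends_or_extends he he').symm.imp (hp _ _) (hp _ _))
  have hf : ∀ z q, (f z).wt q = if q ∈ Finset.univ.image p then a z q else 0 := fun z q ↦
    mk'_wt _ _ _ q
  have hmem : ∀ z, ∀ q ∈ (f z).wt.support, q ∈ Finset.univ.image p ∧ a z q ≠ 0 := by
    intro z q hq
    rw [Finsupp.mem_support_iff, hf] at hq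
    by_cases h : q ∈ Finset.univ.image p
    · rw [if_pos h] at hq
      exact ⟨h, hq⟩
    · simp [h] at hq
  refine ⟨⟨f, continuous_of_support_subset (Finset.univ.image p) (fun z q hq ↦ (hmem z q hq).1)
    fun q hq ↦ ?_⟩, fun z q hq ↦ ha z q (hmem z q hq).2⟩
  simp only [hf, if_pos hq, a]
  refine Continuous.div (continuous_finsetSum _ fun e _ ↦ (continuous_weight _).comp hxc)
    (continuous_finsetSum _ fun e _ ↦ (continuous_weight _).comp hxc) hs

open Classical SignVector in
/-- A poset with a suitable colouring by `r + 1` colours and vertices indexed by the sign vectors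
of length `r` has a non-contractible order complex. -/
theorem not_contractibleSpace_of_coloring {col : P → Set ℕ} (hmono : Monotone col)
    (hne : ∀ q, ∃ j ≤ r, j ∈ col q) (hmiss : ∀ q, ∃ j ≤ r, j ∉ col q)
    {p : {e : Fin r → SignType // e ≠ 0} → P} (hp : ∀ e e', Extends e.1 e'.1 → p e' ≤ p e)
    (hneg : ∀ e (i : Fin r), e.1 i = -1 → (i : ℕ) + 1 ∉ col (p e))
    (hpos : ∀ e (i : Fin r), e.1 i = 1 → ∀ j ≤ (i : ℕ), j ∉ col (p e)) :
    ¬ ContractibleSpace (OrderComplex P) := by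
  intro hcon
  let γ : Metric.closedBall (0 : Fin r → ℝ) 1 → ℝ := fun d ↦ ‖d.1‖
  have hγ : Continuous γ := by fun_prop
  obtain ⟨f, hf⟩ := exists_boundary_map hp (Z := {d // γ d = 1}) (x := fun z ↦ z.1.1)
    (by fun_prop) fun z ↦ z.2
  have hball : ∀ d : Metric.closedBall (0 : Fin r → ℝ) 1, ‖‖d.1‖⁻¹ • d.1‖ ≤ 1 := fun d ↦ by
    rw [norm_smul, norm_inv, norm_norm]
    exact inv_mul_le_one
  have : CompactSpace {d // γ d = 1} :=
    isCompact_iff_compactSpace.1 (isClosed_singleton.preimage hγ).isCompact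
  obtain ⟨F, hF⟩ := (show f.Nullhomotopic from
    ((id_nullhomotopic (OrderComplex P)).comp_left f)).exists_extension hγ
    (fun d ↦ norm_nonneg _) (fun d ↦ mem_closedBall_zero_iff.1 d.2)
    (b := fun d ↦ ⟨‖d.1‖⁻¹ • d.1, mem_closedBall_zero_iff.2 (hball d)⟩)
    (by
      rw [Topology.IsInducing.subtypeVal.continuousOn_iff]
      exact ContinuousOn.smul (hγ.continuousOn.inv₀ fun d hd ↦ hd) (by fun_prop))
    (fun d hd ↦ by
      change ‖‖d.1‖⁻¹ • d.1‖ = 1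
      rw [norm_smul, norm_inv, norm_norm, inv_mul_cancel₀ hd])
    (fun d hd ↦ Subtype.ext (by
      change ‖d.1‖⁻¹ • d.1 = d.1
      rw [show ‖d.1‖ = 1 from hd, inv_one, one_smul]))
  let C : ℕ → Set (Metric.closedBall (0 : Fin r → ℝ) 1) := fun j ↦
    {d | ∀ q ∈ (F d).wt.support, j ∈ col q}
  have hbdry : ∀ (d : Metric.closedBall (0 : Fin r → ℝ) 1) (i : Fin r), |d.1 i| = 1 →
      ∃ e, 0 < ((e.1 i : SignType) : ℝ) * d.1 i ∧ ∀ j, d ∈ C j → j ∈ col (p e) := by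
    intro d i hi
    have hd : ‖d.1‖ = 1 := le_antisymm (mem_closedBall_zero_iff.1 d.2)
      (hi.ge.trans (norm_le_pi_norm d.1 i))
    obtain ⟨q, hq⟩ := (f ⟨d, hd⟩).support_nonempty
    obtain ⟨e, rfl, he⟩ := hf _ q hq
    refine ⟨e, pos_of_abs_eq_one e.2 hd he hi, fun j hj ↦ hj _ ?_⟩
    rwa [hF ⟨d, hd⟩]
  suffices h : ∃ d, ∀ j ≤ r, d ∈ C j by
    obtain ⟨d, hd⟩ := h
    obtain ⟨q, hq⟩ := (F d).support_nonempty
    obtain ⟨j, hj, hjq⟩ := hmiss q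
    exact hjq (hd j hj q hq)
  refine Kuhn.exists_mem_forall (fun j ↦ ?_) (fun d ↦ ?_) (fun d i hi h ↦ ?_)
    fun d i hi j hj h ↦ ?_
  · have : C j = (fun d ↦ integral ({q | j ∈ col q}.indicator 1) (F d)) ⁻¹' {1} := by
      ext d
      exact integral_indicator_eq_one_iff.symm
    rw [this]
    exact isClosed_singleton.preimage ((continuous_integral _).comp F.continuous)
  · obtain ⟨q, hq, hmin⟩ := (F d).exists_le_support
    obtain ⟨j, hj, hjq⟩ := hne q
    exact ⟨j, hj, fun q' hq' ↦ hmono (hmin q' hq') hjq⟩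
  · obtain ⟨e, he, h'⟩ := hbdry d i (by rw [hi]; simp)
    refine hneg e i ?_ (h' _ h)
    rw [hi] at he
    cases hs : e.1 i <;> simp [hs] at he ⊢
    linarith
  · obtain ⟨e, he, h'⟩ := hbdry d i (by rw [hi]; simp)
    refine hpos e i ?_ j hj (h' _ h)
    rw [hi] at he
    cases hs : e.1 i <;> simp [hs] at he ⊢
    linarith

end OrderComplex

namespace CosetPoset

variable {G : Type} [Group G]

lemma exists_le_maximalNormal {N : Subgroup G} (hN : N ∈ properNormal G) :
    ∃ M ∈ maximalNormal G, N ≤ M := by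
  have := hN.1
  have := hN.2.2
  have hfin : {M | N ≤ M ∧ M ∈ properNormal G}.Finite :=
    (finite_setOf_ge N).subset fun _ h ↦ h.1
  obtain ⟨M, hNM, hM⟩ := hfin.exists_le_maximal ⟨le_rfl, hN⟩
  refine ⟨M, ⟨hM.prop.2.1, hM.prop.2.2.1, hM.prop.2.2.2, fun N' h1 h2 h3 h ↦ ?_⟩, hNM⟩
  exact (hM.eq_of_le ⟨hNM.trans h, h1, h2, h3⟩ h).symm

/-- A finite family of subgroups can be thinned out to an irredundant one. -/
lemma exists_irredundant {S : Set (Subgroup G)} (hS : S.Finite) :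
    ∃ (r : ℕ) (A : Fin r → Subgroup G) (s : Fin r → G), (∀ i, A i ∈ S) ∧
      (∀ M ∈ S, ⨅ i, A i ≤ M) ∧ (∀ i, s i ∉ A i) ∧ ∀ i j, i ≠ j → s i ∈ A j := by
  classical
  obtain ⟨T, ⟨hT, hT'⟩, hmin⟩ := wellFounded_lt.has_min
    {T : Finset (Subgroup G) | (∀ A ∈ T, A ∈ S) ∧ ∀ M ∈ S, T.inf id ≤ M}
    ⟨hS.toFinset, by simp, fun M hM ↦ Finset.inf_le (f := id) (hS.mem_toFinset.2 hM)⟩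
  have key : ∀ A ∈ T, ∃ s, s ∉ A ∧ ∀ B ∈ T, A ≠ B → s ∈ B := by
    intro A hA
    by_contra! hcon
    have hle : (T.erase A).inf id ≤ A := by
      intro s hs
      by_contra hsA
      obtain ⟨B, hB, hAB, hsB⟩ := hcon s hsA
      exact hsB (Finset.inf_le (f := id) (Finset.mem_erase.2 ⟨hAB.symm, hB⟩) hs)
    refine hmin (T.erase A) ⟨fun B hB ↦ hT B (Finset.mem_of_mem_erase hB), fun M hM ↦ ?_⟩
      (Finset.erase_ssubset hA)
    refine le_trans (Finset.le_inf fun B hB ↦ ?_) (hT' M hM)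
    by_cases hBA : B = A
    · exact hBA ▸ hle
    · exact Finset.inf_le (f := id) (Finset.mem_erase.2 ⟨hBA, hB⟩)
  choose! s hs hs' using key
  let A : Fin T.card → Subgroup G := fun i ↦ (T.equivFin.symm i).1
  have hA : ∀ i, A i ∈ T := fun i ↦ (T.equivFin.symm i).2
  refine ⟨T.card, A, fun i ↦ s (A i), fun i ↦ hT _ (hA i), fun M hM ↦ ?_, fun i ↦ hs _ (hA i),
    fun i j hij ↦ hs' _ (hA i) _ (hA j) fun h ↦ hij (T.equivFin.symm.injective (Subtype.ext h))⟩
  refine le_trans (Finset.le_inf fun B hB ↦ ?_) (hT' M hM)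
  exact (iInf_le A (T.equivFin ⟨B, hB⟩)).trans (by simp [A])

variable {r : ℕ} {A : Fin r → Subgroup G} {s : Fin r → G}

/-- The largest (one-based) index of a member of the family not containing `x`, or zero. -/
lemma exists_color (A : Fin r → Subgroup G) (x : G) : ∃ k ≤ r, (∀ j : Fin r, k ≤ j → x ∈ A j) ∧
    ∀ i : Fin r, (i : ℕ) + 1 = k → x ∉ A i := by
  classical
  have h : ∃ k : ℕ, ∀ j : Fin r, k ≤ j → x ∈ A j := ⟨r, fun j hj ↦ absurd j.2 hj.not_gt⟩
  refine ⟨Nat.find h, Nat.find_min' h fun j hj ↦ absurd j.2 hj.not_gt, Nat.find_spec h,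
    fun i hi hx ↦ Nat.find_min h (m := i) (by lia) fun j hj ↦ ?_⟩
  rcases eq_or_lt_of_le hj with h' | h'
  · rwa [← Fin.ext h']
  · exact Nat.find_spec h j (by lia)

/-- Cosets of the members of an irredundant family intersect. -/
lemma exists_mem_cosets (hA : ∀ i, (A i).Normal) (hs : ∀ i j, i ≠ j → s i ∈ A j)
    (J : Finset (Fin r)) : ∃ x, (∀ i ∈ J, (s i)⁻¹ * x ∈ A i) ∧ ∀ i ∉ J, x ∈ A i := by
  classical
  induction J using Finset.induction_on with
  | empty => exact ⟨1, by simp, fun i _ ↦ one_mem _⟩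
  | insert i J hi ih =>
    obtain ⟨x, h1, h2⟩ := ih
    refine ⟨x * s i, fun j hj ↦ ?_, fun j hj ↦ ?_⟩
    · rcases Finset.mem_insert.1 hj with rfl | hj
      · rw [← mul_assoc]
        exact (hA j).conj_mem' x (h2 j hi) (s j)
      · rw [← mul_assoc]
        exact mul_mem (h1 j hj) (hs i j fun h ↦ hi (h ▸ hj))
    · rw [Finset.mem_insert, not_or] at hj
      exact mul_mem (h2 j hj.2) (hs i j (Ne.symm hj.1))

/-- A proper normal subgroup contained in a maximal one has no coset meeting all colours. -/
lemma exists_color_notMem (hA : ∀ i, A i ∈ maximalNormal G)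
    (hinf : ∀ M ∈ maximalNormal G, ⨅ i, A i ≤ M) {color : G → ℕ}
    (h1 : ∀ x, ∀ j : Fin r, color x ≤ j → x ∈ A j)
    (h2 : ∀ x, ∀ i : Fin r, (i : ℕ) + 1 = color x → x ∉ A i)
    {H : Subgroup G} (hH : H ∈ properNormal G) (g : G) :
    ∃ j ≤ r, j ∉ color '' (g • (H : Set G)) := by
  by_contra! hcon
  obtain ⟨M, hM, hHM⟩ := exists_le_maximalNormal hH
  have hMn := hM.1
  obtain ⟨x₀, hx₀, h0⟩ := hcon 0 (Nat.zero_le r)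
  have hx₀M : x₀ ∈ M := hinf M hM (Subgroup.mem_iInf.2 fun i ↦ h1 x₀ i (by lia))
  have hsub : ∀ x ∈ g • (H : Set G), x ∈ M := by
    intro x hx
    rw [mem_smul_subgroup] at hx hx₀
    have := mul_mem (M.inv_mem (hHM hx₀)) (hHM hx)
    have e : x = x₀ * ((g⁻¹ * x₀)⁻¹ * (g⁻¹ * x)) := by group
    rw [e]
    exact mul_mem hx₀M this
  have key : ∀ i ≤ r, ∀ x, (∀ j : Fin r, i ≤ j → x ∈ A j) → x ∈ M := by
    intro i
    induction i with
    | zero => exact fun _ x hx ↦ hinf M hM (Subgroup.mem_iInf.2 fun i ↦ hx i (Nat.zero_le _))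
    | succ i ih =>
      intro hi y hy
      let N : Subgroup G := ⨅ j : Fin r, ⨅ _ : i + 1 ≤ j, A j
      have hN : ∀ x, x ∈ N ↔ ∀ j : Fin r, i + 1 ≤ j → x ∈ A j := fun x ↦ by
        simp [N, Subgroup.mem_iInf]
      have hNn : N.Normal := Subgroup.normal_iInf_normal fun j ↦
        Subgroup.normal_iInf_normal fun _ ↦ (hA j).1
      obtain ⟨x, hx, hxi⟩ := hcon (i + 1) hi
      have hnot : ¬ M ⊓ N ≤ A ⟨i, hi⟩ := fun h ↦ h2 x ⟨i, hi⟩ hxi.symm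
        (h ⟨hsub x hx, (hN x).2 fun j hj ↦ h1 x j (hxi ▸ hj)⟩)
      have hAn := (hA ⟨i, hi⟩).1
      have htop : y ∈ (M ⊓ N) ⊔ A ⟨i, hi⟩ := by
        rw [sup_eq_top (hA ⟨i, hi⟩) inferInstance hnot]
        trivial
      obtain ⟨m, hm, a, ha, rfl⟩ := Subgroup.mem_sup_of_normal_right.1 htop
      refine mul_mem hm.1 (ih (by lia) a fun j hj ↦ ?_)
      rcases eq_or_lt_of_le hj with h | h
      · rwa [← show (⟨i, hi⟩ : Fin r) = j from Fin.ext h]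
      · exact ((A j).mul_mem_cancel_left ((hN m).1 hm.2 j h)).1 (hy j h)
  exact hM.2.1 ((Subgroup.eq_top_iff' M).2 fun x ↦ key r le_rfl x fun j hj ↦ absurd j.2 hj.not_gt)

lemma iInf_mem_properNormal (hA : ∀ i, A i ∈ properNormal G) {q : Fin r → Prop}
    (hq : ∃ i, q i) : (⨅ i, ⨅ _ : q i, A i) ∈ properNormal G := by
  obtain ⟨i, hi⟩ := hq
  refine ⟨Subgroup.normal_iInf_normal fun i ↦ Subgroup.normal_iInf_normal fun _ ↦ (hA i).1,
    fun h ↦ (hA i).2.1 (top_le_iff.1 (h ▸ iInf₂_le i hi)), ?_⟩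
  rw [iInf_subtype']
  exact Subgroup.finiteIndex_iInf fun i ↦ (hA i).2.2

open Classical in
theorem not_contractibleSpace_of_finite (hfin : (maximalNormal G).Finite) :
    ¬ ContractibleSpace (OrderComplex (CosetPoset G (properNormal G))) := by
  obtain ⟨r, A, s, hA, hinf, hsi, hsj⟩ := exists_irredundant hfin
  have hAn : ∀ i, (A i).Normal := fun i ↦ (hA i).1
  have hAp : ∀ i, A i ∈ properNormal G := fun i ↦ ⟨(hA i).1, (hA i).2.1, (hA i).2.2.1⟩
  choose color hr h1 h2 using exists_color A
  let t : SignType → Fin r → G := fun σ i ↦ if σ = 1 then s i else 1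
  have ht : ∀ e : Fin r → SignType, ∃ x, ∀ i, (t (e i) i)⁻¹ * x ∈ A i := by
    intro e
    obtain ⟨x, hx, hx'⟩ := exists_mem_cosets hAn hsj (Finset.univ.filter fun i ↦ e i = 1)
    refine ⟨x, fun i ↦ ?_⟩
    by_cases h : e i = 1
    · simpa [t, h] using hx i (by simp [h])
    · simpa [t, h] using hx' i (by simp [h])
  let p : {e : Fin r → SignType // e ≠ 0} → CosetPoset G (properNormal G) := fun e ↦
    ⟨{y | ∀ i, e.1 i ≠ 0 → (t (e.1 i) i)⁻¹ * y ∈ A i}, by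
      obtain ⟨x, hx⟩ := ht e.1
      refine ⟨⨅ i, ⨅ _ : e.1 i ≠ 0, A i, iInf_mem_properNormal hAp (Function.ne_iff.1 e.2), x, ?_⟩
      ext y
      simp only [Set.mem_ofPred_eq, mem_smul_subgroup, Subgroup.mem_iInf]
      refine forall₂_congr fun i _ ↦ ?_
      rw [← (A i).mul_mem_cancel_left (hx i) (y := x⁻¹ * y), mul_assoc, mul_inv_cancel_left]⟩
  refine OrderComplex.not_contractibleSpace_of_coloring (r := r) (col := fun q ↦ color '' q.1)
    (p := p) (fun q q' hq ↦ Set.image_mono hq) ?_ ?_ ?_ ?_ ?_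
  · rintro ⟨_, H, hH, g, rfl⟩
    exact ⟨color g, hr g, g, mem_smul_subgroup.2 (by simp), rfl⟩
  · rintro ⟨_, H, hH, g, rfl⟩
    exact exists_color_notMem hA hinf h1 h2 hH g
  · intro e e' h y hy i hi
    have := hy i (by rwa [h i hi])
    rwa [h i hi] at this
  · rintro e i hi ⟨y, hy, hyi⟩
    have := hy i (by simp [hi])
    exact h2 y i hyi.symm (by simpa [t, hi] using this)
  · rintro e i hi j hj ⟨y, hy, rfl⟩
    have hyi := hy i (by simp [hi])
    refine hsi i ?_
    have h3 : (s i)⁻¹ * y ∈ A i := by simpa [t, hi] using hyi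
    simpa using (A i).inv_mem_iff.1 (((A i).mul_mem_cancel_right (h1 y i hj)).1 h3)

end CosetPoset

/-- **Theorem (Bux–Welsch).** The geometric realization of the nerve of the normal
finite-index coset poset of `G` is contractible if and only if the poset of proper
normal finite-index subgroups of `G` has infinitely many maximal elements. -/
theorem statement3 (G : Type) [Group G] :
    ContractibleSpace
      (cosetNerveRealization G {N : Subgroup G | N.Normal ∧ N ≠ ⊤ ∧ N.FiniteIndex}) ↔
    {M : Subgroup G | M.Normal ∧ M ≠ ⊤ ∧ M.FiniteIndex ∧
      ∀ N : Subgroup G, N.Normal → N ≠ ⊤ → N.FiniteIndex → M ≤ N → N = M}.Infinite := by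
  have e : cosetNerveRealization G (CosetPoset.properNormal G) ≃ₜ
      OrderComplex (CosetPoset G (CosetPoset.properNormal G)) := OrderComplex.nerveHomeo
  rw [e.contractibleSpace_iff]
  refine ⟨fun h hfin ↦ CosetPoset.not_contractibleSpace_of_finite hfin h, fun h ↦ ?_⟩
  exact OrderComplex.contractibleSpace_of_nullhomotopic fun K _ _ u ↦
    OrderComplex.nullhomotopic_of_cone (CosetPoset.exists_cone h) u
end

section
/- Let G be a group in which every proper finite-index subgroup has a complement that is also a proper finite-index subgroup, and let H ≤ G be a subgroup of finite index. Then every proper finite-index subgroup of H has a complement in H that is a proper finite-index subgroup of H. -/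
open scoped Pointwise

/-- If in `G` every proper finite-index subgroup has a complement that is a proper
finite-index subgroup, and `H ≤ G` has finite index, then the same property holds
inside `H`. -/
theorem statement6 {G : Type*} [Group G]
    (hG : ∀ H : Subgroup G, H ≠ ⊤ → H.FiniteIndex →
      ∃ K : Subgroup G, K ≠ ⊤ ∧ K.FiniteIndex ∧ (H : Set G) * (K : Set G) = Set.univ)
    (H : Subgroup G) (hH : H.FiniteIndex) :
    ∀ U : Subgroup ↥H, U ≠ ⊤ → U.FiniteIndex →
      ∃ K : Subgroup ↥H, K ≠ ⊤ ∧ K.FiniteIndex ∧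
        (U : Set ↥H) * (K : Set ↥H) = Set.univ := by
  intro U hU hUfin
  have hmap_ne : U.map H.subtype ≠ ⊤ := by
    refine fun h => hU ((Subgroup.eq_top_iff' U).2 fun x => ?_)
    have hx : (x : G) ∈ U.map H.subtype := h ▸ Subgroup.mem_top _
    obtain ⟨y, hy, hyx⟩ := hx
    rwa [← Subtype.ext hyx]
  have hmap_fin : (U.map H.subtype).FiniteIndex := by
    refine ⟨?_⟩
    rw [Subgroup.index_map_subtype]
    exact mul_ne_zero hUfin.index_ne_zero hH.index_ne_zero
  obtain ⟨L, hL, hLfin, hUL⟩ := hG _ hmap_ne hmap_fin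
  have factor (g : G) : ∃ u ∈ U, ∃ l ∈ L, (u : G) * l = g := by
    have hg : g ∈ (U.map H.subtype : Set G) * (L : Set G) := hUL ▸ Set.mem_univ g
    obtain ⟨_, ⟨u, hu, rfl⟩, l, hl, hul⟩ := hg
    exact ⟨u, hu, l, hl, hul⟩
  refine ⟨L.subgroupOf H, fun h => hL ?_, inferInstance, ?_⟩
  · rw [Subgroup.subgroupOf_eq_top] at h
    refine (Subgroup.eq_top_iff' L).2 fun g => ?_
    obtain ⟨u, -, l, hl, rfl⟩ := factor g
    exact L.mul_mem (h u.2) hl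
  · refine Set.eq_univ_of_forall fun x => ?_
    obtain ⟨u, hu, l, hl, hul⟩ := factor x
    have hlH : l ∈ H := (H.mul_mem_cancel_left u.2).1 (hul ▸ x.2)
    exact ⟨u, hu, ⟨l, hlH⟩, hl, Subtype.ext hul⟩
end

section
/- Let G be a finitely generated group that has infinitely many normal subgroups N of finite index such that the quotient G/N is a simple group. Then every proper finite-index subgroup of G has a complement that is a proper finite-index subgroup of G. -/
open scoped Pointwise

/-- Only finitely many subgroups contain a given normal subgroup of finite index. -/
theorem Subgroup.finite_setOf_le_of_finiteIndex {G : Type*} [Group G] (C : Subgroup G) [C.Normal]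
    [C.FiniteIndex] : {N : Subgroup G | C ≤ N}.Finite := by
  exact Set.finite_coe_iff.mp (Finite.of_equiv _ (QuotientGroup.comapMk'OrderIso C).toEquiv)

/-- If `G ⧸ N` is simple and `C` is a normal subgroup not contained in `N`, then `C * N = G`. -/
theorem Subgroup.mul_eq_univ_of_isSimpleGroup_quotient {G : Type*} [Group G] {C N : Subgroup G}
    [C.Normal] [N.Normal] [IsSimpleGroup (G ⧸ N)] (hCN : ¬ C ≤ N) :
    (C : Set G) * (N : Set G) = Set.univ := by
  have hmap : (C.map (QuotientGroup.mk' N)).Normal :=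
    Subgroup.Normal.map inferInstance _ (QuotientGroup.mk'_surjective N)
  rcases hmap.eq_bot_or_eq_top with hbot | htop
  · rw [Subgroup.map_eq_bot_iff, QuotientGroup.ker_mk'] at hbot
    exact absurd hbot hCN
  · refine Set.eq_univ_of_forall fun g => ?_
    obtain ⟨c, hc, hcg⟩ : (g : G ⧸ N) ∈ C.map (QuotientGroup.mk' N) := htop ▸ Subgroup.mem_top _
    exact ⟨c, hc, c⁻¹ * g, QuotientGroup.eq.mp hcg, mul_inv_cancel_left c g⟩

/-- If a finitely generated group `G` has infinitely many finite-index normal subgroups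
with simple quotient, then every proper finite-index subgroup of `G` has a complement
that is a proper finite-index subgroup. -/
theorem statement9 {G : Type*} [Group G] (hFG : Group.FG G)
    (h : {N : Subgroup G | ∃ hN : N.Normal, N.FiniteIndex ∧
      (haveI := hN; IsSimpleGroup (G ⧸ N))}.Infinite) :
    ∀ H : Subgroup G, H ≠ ⊤ → H.FiniteIndex →
      ∃ K : Subgroup G, K ≠ ⊤ ∧ K.FiniteIndex ∧
        (H : Set G) * (K : Set G) = Set.univ := by
  intro H _ _
  obtain ⟨N, ⟨hN, hfin, hsimple⟩, hle⟩ :=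
    h.exists_notMem_finite (Subgroup.finite_setOf_le_of_finiteIndex H.normalCore)
  refine ⟨N, ?_, hfin, ?_⟩
  · rintro rfl
    exact hle (Set.mem_ofPred.mpr le_top)
  · refine Set.eq_univ_of_univ_subset ?_
    rw [← Subgroup.mul_eq_univ_of_isSimpleGroup_quotient hle]
    exact Set.mul_subset_mul_right H.normalCore_le
end
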